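/- Let C ≥ 1 and b ∈ (0,1) with b ≤ C^{-3}. Let f be a C² diffeomorphism of ℝ² such that |det D_x f| ≤ C·b for all x ∈ ℝ² and such that f has no hyperbolic attracting periodic point. Then every ergodic f-invariant Borel probability measure μ on ℝ² with compact support has two Lyapunov exponents χˢ(μ) < χᵘ(μ), and these satisfy χˢ(μ) ≤ (1/3) log b < 0 ≤ χᵘ(μ). -/

import Mathlib

open MeasureTheory Filter

noncomputable section

/-- The plane. -/
abbrev P2 := ℝ × ℝ

/-- The derivative `D_x f^n` for `n ∈ ℤ`, where `g` is the inverse of `f`. -/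
def DiterZ (f g : P2 → P2) (x : P2) (n : ℤ) : P2 →L[ℝ] P2 :=
  if 0 ≤ n then fderiv ℝ (f^[n.toNat]) x else fderiv ℝ (g^[(-n).toNat]) x

/-- `μ` has two Lyapunov exponents `χs < χu`: μ-a.e. there are invariant
one-dimensional directions (spanned by `es x`, `eu x`) forming a splitting of
the plane, along which the derivatives grow at the exponential rates `χs`
resp. `χu` as `n → ±∞`. -/
def HasTwoLyapunovExponents (f g : P2 → P2) (μ : Measure P2) (χs χu : ℝ) : Prop :=
  χs < χu ∧
  ∃ es eu : P2 → P2, ∀ᵐ x ∂μ,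
    LinearIndependent ℝ ![es x, eu x] ∧
    (∃ c : ℝ, fderiv ℝ f x (es x) = c • es (f x)) ∧
    (∃ c : ℝ, fderiv ℝ f x (eu x) = c • eu (f x)) ∧
    Tendsto (fun n : ℤ => ((n : ℝ))⁻¹ * Real.log ‖DiterZ f g x n (es x)‖)
      atTop (nhds χs) ∧
    Tendsto (fun n : ℤ => ((n : ℝ))⁻¹ * Real.log ‖DiterZ f g x n (es x)‖)
      atBot (nhds χs) ∧
    Tendsto (fun n : ℤ => ((n : ℝ))⁻¹ * Real.log ‖DiterZ f g x n (eu x)‖)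
      atTop (nhds χu) ∧
    Tendsto (fun n : ℤ => ((n : ℝ))⁻¹ * Real.log ‖DiterZ f g x n (eu x)‖)
      atBot (nhds χu)

structure SubCoc {X : Type*} [MeasurableSpace X] (T : X → X) (a : ℕ → X → ℝ) (M : ℝ) : Prop where
  meas : ∀ n, Measurable (a n)
  bdd : ∀ n x, |a n x| ≤ M * n
  sub : ∀ m n x, a (m + n) x ≤ a m x + a n (T^[m] x)

lemma SubCoc.M_nonneg {X : Type*} [MeasurableSpace X] {T : X → X} {a : ℕ → X → ℝ} {M : ℝ}
    (h : SubCoc T a M) (x : X) : 0 ≤ M := by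
  have := h.bdd 1 x
  have h2 := abs_nonneg (a 1 x)
  simp at this; linarith

lemma SubCoc.div_bdd {X : Type*} [MeasurableSpace X] {T : X → X} {a : ℕ → X → ℝ} {M : ℝ}
    (h : SubCoc T a M) (n : ℕ) (x : X) : |a n x / n| ≤ M := by
  have h0 := h.M_nonneg x
  rcases Nat.eq_zero_or_pos n with rfl | hn
  · simpa using h0
  · have : (0:ℝ) < n := by exact_mod_cast hn
    rw [abs_div, abs_of_pos this, div_le_iff₀ this]
    exact h.bdd n x

lemma SubCoc.bddU {X : Type*} [MeasurableSpace X] {T : X → X} {a : ℕ → X → ℝ} {M : ℝ}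
    (h : SubCoc T a M) (x : X) :
    IsBoundedUnder (· ≤ ·) atTop (fun n : ℕ => a n x / n) :=
  isBoundedUnder_of ⟨M, fun n => (abs_le.1 (h.div_bdd n x)).2⟩

lemma SubCoc.bddL {X : Type*} [MeasurableSpace X] {T : X → X} {a : ℕ → X → ℝ} {M : ℝ}
    (h : SubCoc T a M) (x : X) :
    IsBoundedUnder (· ≥ ·) atTop (fun n : ℕ => a n x / n) :=
  isBoundedUnder_of ⟨-M, fun n => (abs_le.1 (h.div_bdd n x)).1⟩

lemma SubCoc.liminf_le {X : Type*} [MeasurableSpace X] {T : X → X} {a : ℕ → X → ℝ} {M : ℝ}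
    (h : SubCoc T a M) (x : X) :
    liminf (fun n : ℕ => a n x / n) atTop ≤ liminf (fun n : ℕ => a n (T x) / n) atTop := by
  refine le_of_forall_lt fun r hr => ?_
  obtain ⟨r', hr1, hr2⟩ := exists_between hr
  have e1 := eventually_lt_of_lt_liminf hr2 (h.bddL x)
  have e2 : ∀ᶠ n : ℕ in atTop, a (n+1) x / ((n+1 : ℕ):ℝ) > r' := (tendsto_add_atTop_nat 1).eventually e1
  obtain ⟨r'', hr3, hr4⟩ := exists_between hr1
  refine lt_of_lt_of_le hr3 ?_
  refine le_liminf_of_le (h.bddU (T x)).isCoboundedUnder_ge ?_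
  have e3 : ∀ᶠ n : ℕ in atTop, (|r'| + M) / (r' - r'') ≤ n :=
    tendsto_natCast_atTop_atTop.eventually_ge_atTop _
  filter_upwards [e2, e3, eventually_gt_atTop 0] with n h1 h2 h3
  have hn : (0:ℝ) < n := by exact_mod_cast h3
  have hn1 : (0:ℝ) < ((n+1:ℕ):ℝ) := by positivity
  have h4 := h.sub 1 n x
  rw [add_comm 1 n] at h4
  have h5 := (abs_le.1 (h.bdd 1 x)).2
  rw [gt_iff_lt, lt_div_iff₀ hn1] at h1
  rw [le_div_iff₀ hn]
  rw [div_le_iff₀ (by linarith)] at h2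
  push_cast at *
  simp at h4 h5
  have := neg_abs_le r'
  nlinarith

lemma SubCoc.liminf_const {X : Type*} [MeasurableSpace X] {T : X → X} {a : ℕ → X → ℝ} {M : ℝ}
    {μ : Measure X} [IsProbabilityMeasure μ] (hT : Ergodic T μ)
    (h : SubCoc T a M) :
    ∃ l : ℝ, ∀ᵐ x ∂μ, (∀ r < l, ∀ᶠ n : ℕ in atTop, r < a n x / n) ∧
      (∀ r > l, ∃ᶠ n : ℕ in atTop, a n x / n < r) := by
  set L : X → ℝ := fun x => liminf (fun n : ℕ => a n x / n) atTop with hL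
  have hLm : Measurable L := Measurable.liminf fun n => (h.meas n).div_const _
  have hLb : ∀ x, ‖L x‖ ≤ M := by
    intro x
    rw [Real.norm_eq_abs, abs_le]
    constructor
    · exact le_liminf_of_le (h.bddU x).isCoboundedUnder_ge
        (Eventually.of_forall fun n => (abs_le.1 (h.div_bdd n x)).1)
    · exact liminf_le_of_le (h.bddL x) fun b hb => by
        obtain ⟨n, hn⟩ := hb.exists
        exact hn.trans (abs_le.1 (h.div_bdd n x)).2
  have hLi : Integrable L μ := Integrable.of_bound hLm.aestronglyMeasurable M (Eventually.of_forall hLb)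
  have hmp := hT.toMeasurePreserving
  have hLT : Integrable (L ∘ T) μ := hmp.integrable_comp_of_integrable hLi
  have heq : ∫ x, L x ∂μ = ∫ x, (L ∘ T) x ∂μ := by
    have : ∫ x, L x ∂(Measure.map T μ) = ∫ x, L (T x) ∂μ :=
      integral_map hmp.measurable.aemeasurable hLm.aestronglyMeasurable
    rw [hmp.map_eq] at this
    exact this
  have hae : L =ᵐ[μ] L ∘ T :=
    (integral_eq_iff_of_ae_le hLi hLT (Eventually.of_forall fun x => h.liminf_le x)).1 heq
  obtain ⟨l, hl⟩ := hT.ae_eq_const_of_ae_eq_comp_ae hLm.aestronglyMeasurable hae.symm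
  refine ⟨l, ?_⟩
  filter_upwards [hl] with x hx
  simp only [Function.const, hL] at hx
  constructor
  · intro r hr
    rw [← hx] at hr
    exact eventually_lt_of_lt_liminf hr (h.bddL x)
  · intro r hr
    rw [← hx] at hr
    exact frequently_lt_of_liminf_lt (h.bddU x).isCoboundedUnder_ge hr

/-- The combinatorial covering estimate. -/
lemma SubCoc.cover {X : Type*} [MeasurableSpace X] {T : X → X} {a : ℕ → X → ℝ} {M : ℝ}
    (h : SubCoc T a M) (l : ℝ) (N : ℕ) (B : Set X)
    (hB : ∀ x ∈ B, ∃ n, 1 ≤ n ∧ n ≤ N ∧ a n x ≤ l * n) (K : ℕ) :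
    ∀ x, a K x ≤ l * K + (M + |l|) * birkhoffSum T (Bᶜ.indicator 1) K x + (M + |l|) * N := by
  have hS : ∀ n x, 0 ≤ birkhoffSum T (Bᶜ.indicator (1 : X → ℝ)) n x := fun n x =>
    Finset.sum_nonneg fun i _ => Set.indicator_nonneg (fun _ _ => zero_le_one) _
  induction K using Nat.strong_induction_on with
  | _ K ih =>
  intro x
  have hM := h.M_nonneg x
  have hl := neg_abs_le l
  have hl0 := abs_nonneg l
  by_cases hK : K ≤ N
  · have h1 := (abs_le.1 (h.bdd K x)).2
    have h2 : (K:ℝ) ≤ N := by exact_mod_cast hK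
    have h3 : (0:ℝ) ≤ K := by positivity
    have h4 := mul_nonneg (add_nonneg hM hl0) (hS K x)
    nlinarith
  push Not at hK
  by_cases hx : x ∈ B
  · obtain ⟨n, hn1, hnN, hn⟩ := hB x hx
    obtain ⟨m, rfl⟩ : ∃ m, K = n + m := ⟨K - n, by omega⟩
    have h1 := h.sub n m x
    have h2 := ih m (by omega) (T^[n] x)
    rw [birkhoffSum_add]
    have h3 := mul_nonneg (add_nonneg hM hl0) (hS n x)
    push_cast
    linarith
  · obtain ⟨m, rfl⟩ : ∃ m, K = 1 + m := ⟨K - 1, by omega⟩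
    have h1 := h.sub 1 m x
    have h2 := ih m (by omega) (T^[1] x)
    rw [birkhoffSum_add]
    have h3 : birkhoffSum T (Bᶜ.indicator (1 : X → ℝ)) 1 x = 1 := by
      simp [hx]
    have h5 := (abs_le.1 (h.bdd 1 x)).2
    rw [h3]
    push_cast at *
    linarith

lemma SubCoc.good_set {X : Type*} [MeasurableSpace X] {T : X → X} {a : ℕ → X → ℝ} {M : ℝ}
    {μ : Measure X} [IsProbabilityMeasure μ]
    (h : SubCoc T a M) (l : ℝ) (hl : ∀ᵐ x ∂μ, ∃ᶠ n : ℕ in atTop, a n x / n < l) (η : ℝ) (hη : 0 < η) :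
    ∃ (N : ℕ) (B : Set X), MeasurableSet B ∧ (∀ x ∈ B, ∃ n, 1 ≤ n ∧ n ≤ N ∧ a n x ≤ l * n) ∧
      μ.real Bᶜ < η := by
  let B : ℕ → Set X := fun N => ⋃ n ∈ Finset.Icc 1 N, {x | a n x ≤ l * n}
  have hBm : ∀ N, MeasurableSet (B N) := fun N =>
    Finset.measurableSet_biUnion _ fun n _ => measurableSet_le (h.meas n) measurable_const
  have hanti : Antitone fun N => (B N)ᶜ := by
    intro N N' hN
    apply Set.compl_subset_compl.2
    apply Set.biUnion_subset_biUnion_left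
    intro n hn
    simp at hn ⊢
    omega
  have ht := tendsto_measure_iInter_atTop (μ := μ) (fun N => (hBm N).compl.nullMeasurableSet) hanti
    ⟨0, measure_ne_top _ _⟩
  have h0 : μ (⋂ N, (B N)ᶜ) = 0 := by
    have : ∀ᵐ x ∂μ, x ∉ ⋂ N, (B N)ᶜ := by
      filter_upwards [hl] with x hx
      obtain ⟨n, hn, hn1⟩ := (hx.and_eventually (eventually_ge_atTop 1)).exists
      simp only [Set.mem_iInter, not_forall, Set.mem_compl_iff, not_not]
      refine ⟨n, Set.mem_biUnion (Finset.mem_coe.2 (Finset.mem_Icc.2 ⟨hn1, le_rfl⟩)) ?_⟩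
      have hp : (0:ℝ) < n := by exact_mod_cast hn1
      rw [div_lt_iff₀ hp] at hn
      exact hn.le
    exact measure_eq_zero_iff_ae_notMem.2 this
  rw [h0] at ht
  have := ht.eventually (gt_mem_nhds (ENNReal.ofReal_pos.2 hη))
  obtain ⟨N, hN⟩ := this.exists
  refine ⟨N, B N, hBm N, ?_, ?_⟩
  · intro x hx
    simp only [B, Set.mem_iUnion, Finset.mem_Icc, Set.mem_ofPred_eq] at hx
    obtain ⟨n, ⟨h1, h2⟩, h3⟩ := hx
    exact ⟨n, h1, h2, h3⟩
  · rw [Measure.real]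
    exact ENNReal.toReal_lt_of_lt_ofReal hN

lemma integral_birkhoff {X : Type*} [MeasurableSpace X] {T : X → X}
    {μ : Measure X} [IsProbabilityMeasure μ] (hT : MeasurePreserving T μ μ) (φ : X → ℝ)
    (hφ : Integrable φ μ) (n : ℕ) :
    Integrable (birkhoffSum T φ n) μ ∧ ∫ x, birkhoffSum T φ n x ∂μ = n * ∫ x, φ x ∂μ := by
  have hi : ∀ k, Integrable (fun x => φ (T^[k] x)) μ := fun k =>
    (hT.iterate k).integrable_comp_of_integrable hφ
  have he : ∀ k, ∫ x, φ (T^[k] x) ∂μ = ∫ x, φ x ∂μ := by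
    intro k
    have hm := hT.iterate k
    have := integral_map hm.measurable.aemeasurable (f := φ) (by rw [hm.map_eq]; exact hφ.1)
    rw [hm.map_eq] at this
    exact this.symm
  constructor
  · exact integrable_finsetSum _ fun k _ => hi k
  · simp only [birkhoffSum]
    rw [integral_finsetSum _ fun k _ => hi k]
    simp [he]

lemma SubCoc.integral_le {X : Type*} [MeasurableSpace X] {T : X → X} {a : ℕ → X → ℝ} {M : ℝ}
    {μ : Measure X} [IsProbabilityMeasure μ] (hT : Ergodic T μ)
    (h : SubCoc T a M) (l : ℝ) (hl : ∀ᵐ x ∂μ, ∃ᶠ n : ℕ in atTop, a n x / n < l) (η : ℝ) (hη : 0 < η) :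
    ∀ᶠ n : ℕ in atTop, ∫ x, a n x ∂μ ≤ (l + η) * n := by
  obtain ⟨x0⟩ : Nonempty X := nonempty_of_isProbabilityMeasure μ
  have hM := h.M_nonneg x0
  have hl0 := abs_nonneg l
  set D := M + |l| + 1 with hD
  have hDp : 0 < D := by positivity
  obtain ⟨N, B, hBm, hB, hμ⟩ := h.good_set l hl (η / (2 * D)) (by positivity)
  have e3 : ∀ᶠ n : ℕ in atTop, 2 * D * N / η ≤ n :=
    tendsto_natCast_atTop_atTop.eventually_ge_atTop _
  filter_upwards [e3] with K hK
  have hind : Integrable (Bᶜ.indicator (1 : X → ℝ)) μ :=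
    (integrable_const (1:ℝ)).indicator hBm.compl
  obtain ⟨hi, he⟩ := integral_birkhoff hT.toMeasurePreserving _ hind K
  have h1 : ∫ x, a K x ∂μ ≤ ∫ x, (l * K + (M + |l|) * birkhoffSum T (Bᶜ.indicator 1) K x
      + (M + |l|) * N) ∂μ := by
    apply integral_mono
    · exact Integrable.of_bound (h.meas K).aestronglyMeasurable (M * K)
        (Eventually.of_forall fun x => h.bdd K x)
    · exact ((integrable_const _).add (hi.const_mul _)).add (integrable_const _)
    · exact fun x => h.cover l N B hB K x
  have hi2 : Integrable (fun x => l * K + (M + |l|) * birkhoffSum T (Bᶜ.indicator (1 : X → ℝ)) K x) μ :=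
    (integrable_const _).add (hi.const_mul _)
  rw [integral_add hi2 (integrable_const _),
    integral_add (integrable_const _) (hi.const_mul _), integral_const_mul (M + |l|), he,
    integral_indicator_one hBm.compl] at h1
  simp at h1
  rw [div_le_iff₀ hη] at hK
  rw [lt_div_iff₀ (by positivity)] at hμ
  have hr : 0 ≤ μ.real Bᶜ := measureReal_nonneg
  have hKp : (0:ℝ) ≤ K := by positivity
  have hNp : (0:ℝ) ≤ N := by positivity
  have h2 : (M + |l|) * (K * μ.real Bᶜ) ≤ D * (K * μ.real Bᶜ) := by
    apply mul_le_mul_of_nonneg_right (by linarith) (by positivity)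
  have h3 : (M + |l|) * N ≤ D * N := by
    apply mul_le_mul_of_nonneg_right (by linarith) (by positivity)
  have h4 : (μ.real Bᶜ * (2 * D)) * K ≤ η * K := mul_le_mul_of_nonneg_right hμ.le hKp
  nlinarith

lemma birkhoff_subCoc {X : Type*} [MeasurableSpace X] {T : X → X} (hTm : Measurable T)
    (φ : X → ℝ) (hφ : Measurable φ) (M : ℝ) (hM : ∀ x, |φ x| ≤ M) :
    SubCoc T (birkhoffSum T φ) M where
  meas n := by
    unfold birkhoffSum
    exact Finset.measurable_sum _ fun k _ => hφ.comp (hTm.iterate k)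
  bdd n x := by
    unfold birkhoffSum
    refine (Finset.abs_sum_le_sum_abs _ _).trans ((Finset.sum_le_sum fun k _ => hM _).trans ?_)
    simp [mul_comm]
  sub m n x := (birkhoffSum_add _ _ _ _ _).le

lemma birkhoff_lower {X : Type*} [MeasurableSpace X] {T : X → X}
    {μ : Measure X} [IsProbabilityMeasure μ] (hT : Ergodic T μ)
    (φ : X → ℝ) (hφ : Measurable φ) (M : ℝ) (hM : ∀ x, |φ x| ≤ M) :
    ∀ᵐ x ∂μ, ∀ r < ∫ x, φ x ∂μ, ∀ᶠ n : ℕ in atTop, r < birkhoffSum T φ n x / n := by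
  have h := birkhoff_subCoc hT.measurable φ hφ M hM
  have hi : Integrable φ μ := Integrable.of_bound hφ.aestronglyMeasurable M (Eventually.of_forall hM)
  obtain ⟨l, hl⟩ := h.liminf_const hT
  have hle : ∫ x, φ x ∂μ ≤ l := by
    refine le_of_forall_pos_le_add fun ε hε => ?_
    have := h.integral_le hT (l + ε/2) (by
      filter_upwards [hl] with x hx
      exact hx.2 _ (by linarith)) (ε/2) (by linarith)
    obtain ⟨n, hn, hn1⟩ := (this.and (eventually_gt_atTop 0)).exists
    rw [(integral_birkhoff hT.toMeasurePreserving φ hi n).2] at hn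
    have : (0:ℝ) < n := by exact_mod_cast hn1
    nlinarith
  filter_upwards [hl] with x hx r hr
  exact hx.1 r (by linarith)

lemma birkhoff_tendsto {X : Type*} [MeasurableSpace X] {T : X → X}
    {μ : Measure X} [IsProbabilityMeasure μ] (hT : Ergodic T μ)
    (φ : X → ℝ) (hφ : Measurable φ) (M : ℝ) (hM : ∀ x, |φ x| ≤ M) :
    ∀ᵐ x ∂μ, Tendsto (fun n : ℕ => birkhoffSum T φ n x / n) atTop (nhds (∫ x, φ x ∂μ)) := by
  filter_upwards [birkhoff_lower hT φ hφ M hM,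
    birkhoff_lower hT (-φ) hφ.neg M (fun x => by simpa using hM x)] with x h1 h2
  refine tendsto_order.2 ⟨h1, fun r hr => ?_⟩
  have := h2 (-r) (by simp [integral_neg]; exact hr)
  filter_upwards [this] with n hn
  have e : birkhoffSum T (-φ) n x = - birkhoffSum T φ n x := by
    simp [birkhoffSum]
  rw [e, neg_div] at hn
  linarith

/-- Kingman's theorem, bounded ergodic case. -/
theorem SubCoc.kingman {X : Type*} [MeasurableSpace X] {T : X → X} {a : ℕ → X → ℝ} {M : ℝ}
    {μ : Measure X} [IsProbabilityMeasure μ] (hT : Ergodic T μ)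
    (h : SubCoc T a M) :
    ∃ l : ℝ, (∀ᵐ x ∂μ, Tendsto (fun n : ℕ => a n x / n) atTop (nhds l)) ∧
      Tendsto (fun n : ℕ => (∫ x, a n x ∂μ) / n) atTop (nhds l) := by
  obtain ⟨x0⟩ : Nonempty X := nonempty_of_isProbabilityMeasure μ
  have hM := h.M_nonneg x0
  obtain ⟨l, hl⟩ := h.liminf_const hT
  have key : ∀ j : ℕ, ∀ᵐ x ∂μ, ∀ᶠ n : ℕ in atTop, a n x / n < l + 1 / ((j:ℝ) + 1) := by
    intro j
    set ε : ℝ := 1 / ((j:ℝ) + 1)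
    have hε : 0 < ε := by positivity
    set l' := l + ε / 2
    set D := M + |l'| + 1 with hD
    have hDp : 0 < D := by positivity
    obtain ⟨N, B, hBm, hB, hμ⟩ := h.good_set (μ := μ) l' (by
      filter_upwards [hl] with x hx
      exact hx.2 _ (by simp only [l']; linarith)) (ε / (4 * D)) (by positivity)
    have hbk := birkhoff_tendsto hT (Bᶜ.indicator (1 : X → ℝ))
      (measurable_one.indicator hBm.compl) 1 (fun x => by
        by_cases hx : x ∈ Bᶜ <;> simp [Set.indicator, hx])
    rw [integral_indicator_one hBm.compl] at hbk
    filter_upwards [hbk] with x hx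
    have e1 := hx.eventually (gt_mem_nhds hμ)
    have e3 : ∀ᶠ n : ℕ in atTop, 8 * D * N / ε ≤ n :=
      tendsto_natCast_atTop_atTop.eventually_ge_atTop _
    filter_upwards [e1, e3, eventually_gt_atTop 0] with n h1 h2 h3
    have hn : (0:ℝ) < n := by exact_mod_cast h3
    have hc := h.cover l' N B hB n x
    rw [div_lt_iff₀ hn] at h1 ⊢
    rw [div_le_iff₀ hε] at h2
    set S := birkhoffSum T (Bᶜ.indicator (1:X → ℝ)) n x with hSd
    have hS : 0 ≤ S := Finset.sum_nonneg fun i _ => Set.indicator_nonneg (fun _ _ => zero_le_one) _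
    have hNp : (0:ℝ) ≤ N := by positivity
    have h4 : (M + |l'|) * S ≤ D * S := mul_le_mul_of_nonneg_right (by linarith) hS
    have h5 : (M + |l'|) * N ≤ D * N := mul_le_mul_of_nonneg_right (by linarith) hNp
    have h6 : D * S < ε / 4 * n := by
      have := mul_lt_mul_of_pos_left h1 hDp
      have e : D * (ε / (4 * D) * n) = ε / 4 * n := by field_simp
      linarith
    have h7 : D * N ≤ ε * n / 8 := by linarith
    have h8 : l' * n = l * n + ε / 2 * n := by simp only [l']; ring
    have h9 : 0 < ε * n := by positivity
    linarith
  have hae : ∀ᵐ x ∂μ, Tendsto (fun n : ℕ => a n x / n) atTop (nhds l) := by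
    filter_upwards [hl, ae_all_iff.2 key] with x h1 h2
    refine tendsto_order.2 ⟨h1.1, fun r hr => ?_⟩
    obtain ⟨j, hj⟩ := exists_nat_one_div_lt (sub_pos.2 hr)
    filter_upwards [h2 j] with n hn
    linarith
  refine ⟨l, hae, ?_⟩
  have := tendsto_integral_of_dominated_convergence (μ := μ) (F := fun n x => a n x / n)
    (f := fun _ => l) (fun _ => M)
    (fun n => ((h.meas n).div_const _).aestronglyMeasurable) (integrable_const _)
    (fun n => Eventually.of_forall fun x => h.div_bdd n x) hae
  simpa [integral_div] using this

/-- Kingman relative to an invariant set of full measure. -/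
theorem kingman_on {X : Type*} [MeasurableSpace X] {T : X → X} {a : ℕ → X → ℝ} {M : ℝ}
    {μ : Measure X} [IsProbabilityMeasure μ] (hT : Ergodic T μ) (S : Set X) (hS : MeasurableSet S)
    (hST : ∀ x, T x ∈ S ↔ x ∈ S) (hSμ : ∀ᵐ x ∂μ, x ∈ S) (hM : 0 ≤ M)
    (hmeas : ∀ n, Measurable (a n)) (hbdd : ∀ n, ∀ x ∈ S, |a n x| ≤ M * n)
    (hsub : ∀ m n, ∀ x ∈ S, a (m + n) x ≤ a m x + a n (T^[m] x)) :
    ∃ l : ℝ, (∀ᵐ x ∂μ, Tendsto (fun n : ℕ => a n x / n) atTop (nhds l)) ∧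
      Tendsto (fun n : ℕ => (∫ x, a n x ∂μ) / n) atTop (nhds l) := by
  have hSn : ∀ n x, T^[n] x ∈ S ↔ x ∈ S := by
    intro n
    induction n with
    | zero => simp
    | succ n ih => intro x; rw [Function.iterate_succ_apply, ih, hST]
  have h : SubCoc T (fun n => S.indicator (a n)) M :=
    { meas := fun n => (hmeas n).indicator hS
      bdd := fun n x => by
        by_cases hx : x ∈ S
        · simpa [hx] using hbdd n x hx
        · simp [hx]; positivity
      sub := fun m n x => by
        by_cases hx : x ∈ S
        · simpa [hx, hSn] using hsub m n x hx
        · simp [hx, hSn] }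
  obtain ⟨l, h1, h2⟩ := h.kingman hT
  refine ⟨l, ?_, ?_⟩
  · filter_upwards [h1, hSμ] with x hx hxS
    simpa [hxS] using hx
  · convert h2 using 3 with n
    apply integral_congr_ae
    filter_upwards [hSμ] with x hx
    simp [hx]


def wd (u v : P2) : ℝ := u.1 * v.2 - u.2 * v.1

def dt (A : P2 →L[ℝ] P2) : ℝ := LinearMap.det A.toLinearMap

lemma map_eq (A : P2 →L[ℝ] P2) (v : P2) : A v = v.1 • A (1, 0) + v.2 • A (0, 1) := by
  rw [← map_smul, ← map_smul, ← map_add]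
  congr 1
  ext <;> simp

lemma dt_eq (A : P2 →L[ℝ] P2) : dt A = wd (A (1, 0)) (A (0, 1)) := by
  unfold dt
  rw [← LinearMap.det_toMatrix (Module.Basis.finTwoProd ℝ), Matrix.det_fin_two]
  simp [LinearMap.toMatrix_apply, wd]
  ring

lemma wd_map (A : P2 →L[ℝ] P2) (u v : P2) : wd (A u) (A v) = dt A * wd u v := by
  rw [dt_eq, map_eq A u, map_eq A v]
  simp [wd]
  ring

lemma abs_wd_le (u v : P2) : |wd u v| ≤ 2 * ‖u‖ * ‖v‖ := by
  have h1 : |u.1| ≤ ‖u‖ := norm_fst_le u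
  have h2 : |u.2| ≤ ‖u‖ := norm_snd_le u
  have h3 : |v.1| ≤ ‖v‖ := norm_fst_le v
  have h4 : |v.2| ≤ ‖v‖ := norm_snd_le v
  unfold wd
  refine (abs_sub _ _).trans ?_
  rw [abs_mul, abs_mul]
  nlinarith [mul_le_mul h1 h4 (abs_nonneg _) (norm_nonneg u), mul_le_mul h2 h3 (abs_nonneg _) (norm_nonneg u)]

lemma opnorm_le (A : P2 →L[ℝ] P2) (R : ℝ) (h1 : ‖A (1, 0)‖ ≤ R) (h2 : ‖A (0, 1)‖ ≤ R) :
    ‖A‖ ≤ 2 * R := by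
  have hR : 0 ≤ R := (norm_nonneg _).trans h1
  refine A.opNorm_le_bound (by positivity) fun v => ?_
  rw [map_eq A v]
  refine (norm_add_le _ _).trans ?_
  rw [norm_smul, norm_smul]
  have h3 := norm_fst_le v
  have h4 := norm_snd_le v
  nlinarith [mul_le_mul h3 h1 (norm_nonneg _) (norm_nonneg v), mul_le_mul h4 h2 (norm_nonneg _) (norm_nonneg v)]

lemma exists_contracted (A : P2 →L[ℝ] P2) :
    ∃ s : P2, s.1 ^ 2 + s.2 ^ 2 = 1 ∧ ‖A‖ * ‖A s‖ ≤ 4 * |dt A| := by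
  obtain ⟨a, c, hac⟩ : ∃ a c, A (1, 0) = (a, c) := ⟨_, _, rfl⟩
  obtain ⟨b, d, hbd⟩ : ∃ b d, A (0, 1) = (b, d) := ⟨_, _, rfl⟩
  have hdt : dt A = a * d - c * b := by rw [dt_eq, hac, hbd]; rfl
  have hA : ∀ s : P2, A s = (s.1 * a + s.2 * b, s.1 * c + s.2 * d) := by
    intro s; rw [map_eq A s, hac, hbd]; ext <;> simp
  have main : ∀ p q : ℝ, (a ^ 2 ≤ p ^ 2 + q ^ 2 ∧ b ^ 2 ≤ p ^ 2 + q ^ 2 ∧ c ^ 2 ≤ p ^ 2 + q ^ 2 ∧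
      d ^ 2 ≤ p ^ 2 + q ^ 2) → (‖A (-q, p)‖ ≤ |dt A|) → 
      ∃ s : P2, s.1 ^ 2 + s.2 ^ 2 = 1 ∧ ‖A‖ * ‖A s‖ ≤ 4 * |dt A| := by
    rintro p q ⟨h1, h2, h3, h4⟩ h5
    set R := Real.sqrt (p ^ 2 + q ^ 2) with hR
    have hR0 : 0 ≤ R := Real.sqrt_nonneg _
    have hR2 : R ^ 2 = p ^ 2 + q ^ 2 := Real.sq_sqrt (by positivity)
    rw [← hR2] at h1 h2 h3 h4
    have k1 := abs_le_of_sq_le_sq h1 hR0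
    have k2 := abs_le_of_sq_le_sq h2 hR0
    have k3 := abs_le_of_sq_le_sq h3 hR0
    have k4 := abs_le_of_sq_le_sq h4 hR0
    have hn : ‖A‖ ≤ 2 * R := by
      apply opnorm_le
      · rw [hac]; exact max_le k1 k3
      · rw [hbd]; exact max_le k2 k4
    rcases hR0.eq_or_lt with h0 | hpos
    · refine ⟨(1, 0), by norm_num, ?_⟩
      have : ‖A‖ = 0 := le_antisymm (by linarith) (norm_nonneg _)
      rw [this, zero_mul]; positivity
    · refine ⟨R⁻¹ • (-q, p), ?_, ?_⟩
      · simp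
        have : (R⁻¹ * q) ^ 2 + (R⁻¹ * p) ^ 2 = R⁻¹ ^ 2 * R ^ 2 := by rw [hR2]; ring
        rw [this, ← mul_pow, inv_mul_cancel₀ hpos.ne', one_pow]
      · rw [map_smul, norm_smul, norm_inv, Real.norm_of_nonneg hR0]
        calc ‖A‖ * (R⁻¹ * ‖A (-q, p)‖) ≤ (2 * R) * (R⁻¹ * |dt A|) := by gcongr
          _ = 2 * |dt A| := by field_simp
          _ ≤ 4 * |dt A| := by linarith [abs_nonneg (dt A)]
  rcases le_total (a ^ 2 + b ^ 2) (c ^ 2 + d ^ 2) with h | h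
  · apply main c d
    · refine ⟨?_, ?_, ?_, ?_⟩ <;> nlinarith [sq_nonneg a, sq_nonneg b, sq_nonneg c, sq_nonneg d]
    · rw [hA, hdt]
      apply max_le
      · simp only [Real.norm_eq_abs]
        rw [abs_sub_comm]; apply le_of_eq; congr 1; ring
      · simp only [Real.norm_eq_abs]
        have : -d * c + c * d = 0 := by ring
        rw [this, abs_zero]; positivity
  · apply main a b
    · refine ⟨?_, ?_, ?_, ?_⟩ <;> nlinarith [sq_nonneg a, sq_nonneg b, sq_nonneg c, sq_nonneg d]
    · rw [hA, hdt]
      apply max_le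
      · simp only [Real.norm_eq_abs]
        have : -b * a + a * b = 0 := by ring
        rw [this, abs_zero]; positivity
      · simp only [Real.norm_eq_abs]
        apply le_of_eq; congr 1; ring

lemma wd_triangle (s t u : P2) (hs : s.1 ^ 2 + s.2 ^ 2 = 1) (ht : t.1 ^ 2 + t.2 ^ 2 = 1)
    (hu : u.1 ^ 2 + u.2 ^ 2 = 1) : |wd s u| ≤ |wd s t| + |wd t u| := by
  have key : wd s u = wd s t * (t.1 * u.1 + t.2 * u.2) + (s.1 * t.1 + s.2 * t.2) * wd t u := by
    have : wd s u = wd s u * (t.1 ^ 2 + t.2 ^ 2) := by rw [ht, mul_one]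
    rw [this]; unfold wd; ring
  have h1 : |t.1 * u.1 + t.2 * u.2| ≤ 1 := by
    apply abs_le_of_sq_le_sq _ zero_le_one
    nlinarith [sq_nonneg (t.1 * u.2 - t.2 * u.1)]
  have h2 : |s.1 * t.1 + s.2 * t.2| ≤ 1 := by
    apply abs_le_of_sq_le_sq _ zero_le_one
    nlinarith [sq_nonneg (s.1 * t.2 - s.2 * t.1)]
  rw [key]
  refine (abs_add_le _ _).trans ?_
  rw [abs_mul, abs_mul]
  have := mul_le_mul_of_nonneg_left h1 (abs_nonneg (wd s t))
  have := mul_le_mul_of_nonneg_right h2 (abs_nonneg (wd t u))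
  linarith

lemma norm_map_le (A : P2 →L[ℝ] P2) (s k : P2) (hs : s.1 ^ 2 + s.2 ^ 2 = 1)
    (hk : k.1 ^ 2 + k.2 ^ 2 = 1) : ‖A s‖ ≤ ‖A k‖ + |wd k s| * ‖A‖ := by
  have hd : s = (s.1 * k.1 + s.2 * k.2) • k + wd k s • (-k.2, k.1) := by
    have h1 : s.1 = s.1 * (k.1 ^ 2 + k.2 ^ 2) := by rw [hk, mul_one]
    have h2 : s.2 = s.2 * (k.1 ^ 2 + k.2 ^ 2) := by rw [hk, mul_one]
    ext
    · simp [wd]; linear_combination h1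
    · simp [wd]; linear_combination h2
  have h1 : |s.1 * k.1 + s.2 * k.2| ≤ 1 := by
    apply abs_le_of_sq_le_sq _ zero_le_one
    nlinarith [sq_nonneg (s.1 * k.2 - s.2 * k.1)]
  have h2 : ‖((-k.2, k.1) : P2)‖ ≤ 1 := by
    apply max_le
    · simp only [Real.norm_eq_abs]
      apply abs_le_of_sq_le_sq _ zero_le_one
      nlinarith [sq_nonneg k.1]
    · simp only [Real.norm_eq_abs]
      apply abs_le_of_sq_le_sq _ zero_le_one
      nlinarith [sq_nonneg k.2]
  calc ‖A s‖ = ‖(s.1 * k.1 + s.2 * k.2) • A k + wd k s • A (-k.2, k.1)‖ := by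
        conv_lhs => rw [hd]
        rw [map_add, map_smul, map_smul]
    _ ≤ |s.1 * k.1 + s.2 * k.2| * ‖A k‖ + |wd k s| * ‖A (-k.2, k.1)‖ := by
        refine (norm_add_le _ _).trans ?_
        rw [norm_smul, norm_smul, Real.norm_eq_abs, Real.norm_eq_abs]
    _ ≤ 1 * ‖A k‖ + |wd k s| * ‖A‖ := by
        gcongr
        exact (A.le_opNorm _).trans (by nlinarith [norm_nonneg A])
    _ = _ := by ring

def Rate (c : ℕ → ℝ) (r : ℝ) : Prop := Tendsto (fun n : ℕ => Real.log (c n) / n) atTop (nhds r)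

lemma Rate.le {c : ℕ → ℝ} {r : ℝ} (h : Rate c r) (hc : ∀ n, 0 < c n) {ε : ℝ} (hε : 0 < ε) :
    ∀ᶠ n : ℕ in atTop, c n ≤ Real.exp (n * (r + ε)) := by
  filter_upwards [h.eventually (gt_mem_nhds (lt_add_of_pos_right r hε)), eventually_gt_atTop 0]
    with n h1 h2
  have : (0:ℝ) < n := by exact_mod_cast h2
  rw [div_lt_iff₀ this] at h1
  rw [← Real.log_le_iff_le_exp (hc n)]
  linarith

lemma Rate.ge {c : ℕ → ℝ} {r : ℝ} (h : Rate c r) (hc : ∀ n, 0 < c n) {ε : ℝ} (hε : 0 < ε) :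
    ∀ᶠ n : ℕ in atTop, Real.exp (n * (r - ε)) ≤ c n := by
  filter_upwards [h.eventually (lt_mem_nhds (sub_lt_self r hε)), eventually_gt_atTop 0]
    with n h1 h2
  have : (0:ℝ) < n := by exact_mod_cast h2
  rw [lt_div_iff₀ this] at h1
  rw [← Real.le_log_iff_exp_le (hc n)]
  linarith

lemma Rate.of_bounds {c : ℕ → ℝ} {r : ℝ}
    (h1 : ∀ ε > 0, ∀ᶠ n : ℕ in atTop, Real.exp (n * (r - ε)) ≤ c n)
    (h2 : ∀ ε > 0, ∀ᶠ n : ℕ in atTop, c n ≤ Real.exp (n * (r + ε))) : Rate c r := by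
  refine tendsto_order.2 ⟨fun q hq => ?_, fun q hq => ?_⟩
  · filter_upwards [h1 ((r - q)/2) (by linarith), eventually_gt_atTop 0] with n h3 h4
    have : (0:ℝ) < n := by exact_mod_cast h4
    rw [lt_div_iff₀ this]
    have := (Real.le_log_iff_exp_le (lt_of_lt_of_le (Real.exp_pos _) h3)).2 h3
    nlinarith
  · filter_upwards [h1 1 one_pos, h2 ((q - r)/2) (by linarith), eventually_gt_atTop 0] with n h5 h3 h4
    have : (0:ℝ) < n := by exact_mod_cast h4
    rw [div_lt_iff₀ this]
    have := (Real.log_le_iff_le_exp (lt_of_lt_of_le (Real.exp_pos _) h5)).2 h3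
    nlinarith

lemma ev_const (D : ℝ) {ε : ℝ} (hε : 0 < ε) : ∀ᶠ n : ℕ in atTop, D ≤ Real.exp (n * ε) := by
  have h : Tendsto (fun n : ℕ => Real.exp (n * ε)) atTop atTop :=
    Real.tendsto_exp_atTop.comp (tendsto_natCast_atTop_atTop.atTop_mul_const hε)
  exact h.eventually_ge_atTop D

def Slow (A : ℕ → P2 →L[ℝ] P2) (χ : ℝ) (v : P2) : Prop :=
  ∀ ε > 0, ∀ᶠ n : ℕ in atTop, ‖A n v‖ ≤ Real.exp (n * (χ + ε))

structure PW (A : ℕ → P2 →L[ℝ] P2) (l d L : ℝ) : Prop where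
  dt0 : ∀ n, dt (A n) ≠ 0
  Lpos : 0 < L
  step : ∀ n v, ‖A n v‖ ≤ L * ‖A (n+1) v‖
  rl : Rate (fun n => ‖A n‖) l
  rd : Rate (fun n => |dt (A n)|) d
  gap : d < 2 * l

lemma norm_pos_of_dt {A : P2 →L[ℝ] P2} (h : dt A ≠ 0) : 0 < ‖A‖ := by
  rw [norm_pos_iff]
  rintro rfl
  apply h
  rw [dt_eq]; simp [wd]

lemma map_ne_of_dt {A : P2 →L[ℝ] P2} (h : dt A ≠ 0) {v : P2} (hv : v ≠ 0) : A v ≠ 0 := by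
  intro h0
  apply hv
  have h1 : ∀ w, wd v w = 0 := by
    intro w
    have := wd_map A v w
    rw [h0] at this
    have h2 : dt A * wd v w = 0 := by rw [← this]; simp [wd]
    exact (mul_eq_zero.1 h2).resolve_left h
  have e1 := h1 (1, 0)
  have e2 := h1 (0, 1)
  simp [wd] at e1 e2
  ext <;> simp [e1, e2]

lemma PW.wd_step {A : ℕ → P2 →L[ℝ] P2} {l d L : ℝ} (h : PW A l d L) (s : ℕ → P2)
    (hs2 : ∀ n, ‖A n‖ * ‖A n (s n)‖ ≤ 4 * |dt (A n)|) (j : ℕ) :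
    |wd (s j) (s (j+1))| * (‖A (j+1)‖ * ‖A j‖) ≤ 32 * L * |dt (A (j+1))| := by
  have hd : 0 < |dt (A j)| := abs_pos.2 (h.dt0 j)
  have hL := h.Lpos
  have h1 : |dt (A j)| * |wd (s j) (s (j+1))| ≤ 2 * ‖A j (s j)‖ * ‖A j (s (j+1))‖ := by
    rw [← abs_mul, ← wd_map]; exact abs_wd_le _ _
  have h2 := h.step j (s (j+1))
  have h3 := hs2 j
  have h4 := hs2 (j+1)
  refine le_of_mul_le_mul_left ?_ hd
  calc |dt (A j)| * (|wd (s j) (s (j+1))| * (‖A (j+1)‖ * ‖A j‖))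
      = (|dt (A j)| * |wd (s j) (s (j+1))|) * (‖A (j+1)‖ * ‖A j‖) := by ring
    _ ≤ (2 * ‖A j (s j)‖ * (L * ‖A (j+1) (s (j+1))‖)) * (‖A (j+1)‖ * ‖A j‖) := by
        refine mul_le_mul_of_nonneg_right (h1.trans ?_) (by positivity)
        gcongr
    _ = 2 * L * (‖A j‖ * ‖A j (s j)‖) * (‖A (j+1)‖ * ‖A (j+1) (s (j+1))‖) := by ring
    _ ≤ 2 * L * (4 * |dt (A j)|) * (4 * |dt (A (j+1))|) := by gcongr
    _ = _ := by ring

lemma PW.exists_slow {A : ℕ → P2 →L[ℝ] P2} {l d L : ℝ} (h : PW A l d L) :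
    ∃ s : P2, s.1 ^ 2 + s.2 ^ 2 = 1 ∧ Slow A (d - l) s := by
  choose s hs1 hs2 using fun n => exists_contracted (A n)
  have hcpt : IsCompact {v : P2 | v.1 ^ 2 + v.2 ^ 2 = 1} := by
    apply Metric.isCompact_of_isClosed_isBounded
    · exact isClosed_eq (by fun_prop) continuous_const
    · refine (Metric.isBounded_closedBall (x := (0:P2)) (r := 1)).subset fun v hv => ?_
      simp only [Set.mem_ofPred_eq] at hv
      rw [mem_closedBall_zero_iff]
      apply max_le
      · simp only [Real.norm_eq_abs]
        apply abs_le_of_sq_le_sq _ zero_le_one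
        nlinarith [sq_nonneg v.2]
      · simp only [Real.norm_eq_abs]
        apply abs_le_of_sq_le_sq _ zero_le_one
        nlinarith [sq_nonneg v.1]
  obtain ⟨σ, hσ, φ, hφ, hlim⟩ := hcpt.tendsto_subseq (x := s) hs1
  refine ⟨σ, hσ, fun ε0 hε0 => ?_⟩
  have hgap := h.gap
  obtain ⟨ε, hε, hε1, hε2⟩ : ∃ ε > 0, 5 * ε ≤ ε0 ∧ 6 * ε ≤ 2 * l - d :=
    ⟨min (ε0 / 5) ((2 * l - d) / 6), lt_min (by linarith) (by linarith),
      by linarith [min_le_left (ε0 / 5) ((2 * l - d) / 6)],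
      by linarith [min_le_right (ε0 / 5) ((2 * l - d) / 6)]⟩
  set κ := 2 * l - d - 3 * ε with hκ
  have hκ0 : 0 < κ := by linarith
  set D := 32 * L * Real.exp (d - l + 2 * ε) with hD
  have hL := h.Lpos
  have hD0 : 0 < D := by positivity
  have hnp : ∀ n, 0 < ‖A n‖ := fun n => norm_pos_of_dt (h.dt0 n)
  have hdp : ∀ n, 0 < |dt (A n)| := fun n => abs_pos.2 (h.dt0 n)
  have e1 := h.rl.ge hnp hε
  have e2 := h.rd.le hdp hε
  have e3 := h.rl.le hnp hε
  obtain ⟨J, hJ⟩ := eventually_atTop.1 ((e1.and e2).and e3)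
  have hstep : ∀ j ≥ J, |wd (s j) (s (j+1))| ≤ D * Real.exp (-(j * κ)) := by
    intro j hj
    have h1 := h.wd_step s hs2 j
    obtain ⟨⟨ha, -⟩, -⟩ := hJ j hj
    obtain ⟨⟨hb, hc⟩, -⟩ := hJ (j+1) (by omega)
    have hpp : 0 < Real.exp ((j+1:ℕ) * (l - ε)) * Real.exp (j * (l - ε)) := by positivity
    refine le_of_mul_le_mul_right ?_ hpp
    calc |wd (s j) (s (j+1))| * (Real.exp ((j+1:ℕ) * (l - ε)) * Real.exp (j * (l - ε)))
        ≤ |wd (s j) (s (j+1))| * (‖A (j+1)‖ * ‖A j‖) := by gcongr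
      _ ≤ 32 * L * |dt (A (j+1))| := h1
      _ ≤ 32 * L * Real.exp ((j+1:ℕ) * (d + ε)) := by gcongr
      _ = _ := by
        rw [hD]
        simp only [mul_assoc, ← Real.exp_add]
        congr 3
        push_cast; rw [hκ]; ring
  set q := 1 - Real.exp (-κ) with hq
  have hq0 : 0 < q := by
    have : Real.exp (-κ) < 1 := by rw [← Real.exp_zero]; exact Real.exp_lt_exp.2 (by linarith)
    linarith
  have htel : ∀ k ≥ J, ∀ i : ℕ, |wd (s k) (s (k + i))| ≤
      D / q * (Real.exp (-(k * κ)) - Real.exp (-((k + i : ℕ) * κ))) := by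
    intro k hk i
    induction i with
    | zero => simp [wd, mul_comm]
    | succ i ih =>
      have h1 := wd_triangle _ _ _ (hs1 k) (hs1 (k+i)) (hs1 (k+(i+1)))
      have h2 := hstep (k+i) (by omega)
      have h3 : Real.exp (-((k + (i+1) : ℕ) * κ)) = Real.exp (-((k + i : ℕ) * κ)) * Real.exp (-κ) := by
        rw [← Real.exp_add]; congr 1; push_cast; ring
      have h4 : D * Real.exp (-((k + i : ℕ) * κ)) =
          D / q * (Real.exp (-((k + i : ℕ) * κ)) - Real.exp (-((k + (i+1) : ℕ) * κ))) := by
        rw [h3]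
        have : Real.exp (-((k + i : ℕ) * κ)) - Real.exp (-((k + i : ℕ) * κ)) * Real.exp (-κ)
          = Real.exp (-((k + i : ℕ) * κ)) * q := by rw [hq]; ring
        rw [this]; field_simp
      rw [h4] at h2
      have h5 : D / q * (Real.exp (-(k * κ)) - Real.exp (-((k + (i+1) : ℕ) * κ))) =
        D / q * (Real.exp (-(k * κ)) - Real.exp (-((k + i : ℕ) * κ))) +
        D / q * (Real.exp (-((k + i : ℕ) * κ)) - Real.exp (-((k + (i+1) : ℕ) * κ))) := by ring
      rw [h5]
      exact h1.trans (add_le_add ih h2)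
  have hlimw : ∀ k ≥ J, |wd (s k) σ| ≤ D / q * Real.exp (-(k * κ)) := by
    intro k hk
    have hc : Continuous fun v : P2 => |wd (s k) v| := by unfold wd; fun_prop
    have ht : Tendsto (fun n => |wd (s k) (s (φ n))|) atTop (nhds |wd (s k) σ|) :=
      (hc.tendsto σ).comp hlim
    refine le_of_tendsto ht ?_
    filter_upwards [hφ.tendsto_atTop.eventually_ge_atTop k] with n hn
    obtain ⟨i, hi⟩ := Nat.exists_eq_add_of_le hn
    rw [hi]
    refine (htel k hk i).trans ?_
    gcongr
    linarith [Real.exp_pos (-((k + i : ℕ) * κ))]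
  filter_upwards [eventually_ge_atTop J, ev_const (4 + D / q) hε] with k hk hkc
  obtain ⟨⟨ha, hb⟩, hc⟩ := hJ k hk
  have hmain := norm_map_le (A k) σ (s k) hσ (hs1 k)
  have hsk : ‖A k (s k)‖ ≤ 4 * Real.exp (k * (d - l + 2 * ε)) := by
    refine le_of_mul_le_mul_left ?_ (Real.exp_pos (k * (l - ε)))
    calc Real.exp (k * (l - ε)) * ‖A k (s k)‖ ≤ ‖A k‖ * ‖A k (s k)‖ := by gcongr
      _ ≤ 4 * |dt (A k)| := hs2 k
      _ ≤ 4 * Real.exp (k * (d + ε)) := by gcongr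
      _ = Real.exp (k * (l - ε)) * (4 * Real.exp (k * (d - l + 2 * ε))) := by
        rw [mul_left_comm, ← Real.exp_add]; congr 2; ring
  have hk0 : (0:ℝ) ≤ k := by positivity
  calc ‖A k σ‖ ≤ ‖A k (s k)‖ + |wd (s k) σ| * ‖A k‖ := hmain
    _ ≤ 4 * Real.exp (k * (d - l + 2 * ε)) + D / q * Real.exp (-(k * κ)) * Real.exp (k * (l + ε)) := by
        gcongr
        exact hlimw k hk
    _ ≤ 4 * Real.exp (k * (d - l + 4 * ε)) + D / q * Real.exp (k * (d - l + 4 * ε)) := by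
        apply add_le_add
        · gcongr; linarith
        · rw [mul_assoc, ← Real.exp_add]
          apply le_of_eq; congr 2; rw [hκ]; ring
    _ = (4 + D / q) * Real.exp (k * (d - l + 4 * ε)) := by ring
    _ ≤ Real.exp (k * ε) * Real.exp (k * (d - l + 4 * ε)) := by gcongr
    _ = Real.exp (k * (d - l + 5 * ε)) := by rw [← Real.exp_add]; congr 1; ring
    _ ≤ Real.exp (k * (d - l + ε0)) := by gcongr

lemma PW.rate_fast {A : ℕ → P2 →L[ℝ] P2} {l d L : ℝ} (h : PW A l d L) {s v : P2}
    (hs : Slow A (d - l) s) (hsv : wd s v ≠ 0) : Rate (fun n => ‖A n v‖) l := by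
  have hnp : ∀ n, 0 < ‖A n‖ := fun n => norm_pos_of_dt (h.dt0 n)
  have hdp : ∀ n, 0 < |dt (A n)| := fun n => abs_pos.2 (h.dt0 n)
  have hw : 0 < |wd s v| := abs_pos.2 hsv
  apply Rate.of_bounds
  · intro ε hε
    filter_upwards [hs (ε/4) (by linarith), h.rd.ge hdp (ε := ε/4) (by linarith),
      ev_const (2 / |wd s v|) (ε := ε/2) (by linarith)] with n h1 h2 h3
    have h4 : |dt (A n)| * |wd s v| ≤ 2 * ‖A n s‖ * ‖A n v‖ := by
      rw [← abs_mul, ← wd_map]; exact abs_wd_le _ _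
    rw [div_le_iff₀ hw] at h3
    have h5 : Real.exp (n * (d - ε/4)) * |wd s v| ≤ 2 * Real.exp (n * (d - l + ε/4)) * ‖A n v‖ :=
      calc _ ≤ |dt (A n)| * |wd s v| := by gcongr
        _ ≤ _ := h4
        _ ≤ _ := by gcongr
    have h6 : 2 * Real.exp (n * (d - ε/4)) ≤ Real.exp (n * (ε/2)) * (2 * Real.exp (n * (d - l + ε/4)) * ‖A n v‖) := 
      calc 2 * Real.exp (n * (d - ε/4)) ≤ (Real.exp (n * (ε/2)) * |wd s v|) * Real.exp (n * (d - ε/4)) := by gcongr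
        _ = Real.exp (n * (ε/2)) * (Real.exp (n * (d - ε/4)) * |wd s v|) := by ring
        _ ≤ _ := by gcongr
    have h7 : Real.exp (n * (d - ε/4)) = Real.exp (n * (ε/2)) * Real.exp (n * (d - l + ε/4)) * Real.exp (n * (l - ε)) := by
      rw [← Real.exp_add, ← Real.exp_add]; congr 1; ring
    rw [h7] at h6
    refine le_of_mul_le_mul_left ?_ (by positivity : 0 < 2 * (Real.exp (n * (ε/2)) * Real.exp (n * (d - l + ε/4))))
    linarith
  · intro ε hε
    filter_upwards [h.rl.le hnp (ε := ε/2) (by linarith), ev_const ‖v‖ (ε := ε/2) (by linarith)] with n h1 h2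
    calc ‖A n v‖ ≤ ‖A n‖ * ‖v‖ := (A n).le_opNorm v
      _ ≤ Real.exp (n * (l + ε/2)) * Real.exp (n * (ε/2)) := by gcongr
      _ = _ := by rw [← Real.exp_add]; congr 1; ring

lemma PW.rate_slow {A : ℕ → P2 →L[ℝ] P2} {l d L : ℝ} (h : PW A l d L) {s : P2} (hs0 : s ≠ 0)
    (hs : Slow A (d - l) s) : Rate (fun n => ‖A n s‖) (d - l) := by
  have hnp : ∀ n, 0 < ‖A n‖ := fun n => norm_pos_of_dt (h.dt0 n)
  have hdp : ∀ n, 0 < |dt (A n)| := fun n => abs_pos.2 (h.dt0 n)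
  obtain ⟨v, hv⟩ : ∃ v, wd s v ≠ 0 := by
    by_contra! hc
    apply hs0
    have e1 := hc (1, 0)
    have e2 := hc (0, 1)
    simp [wd] at e1 e2
    ext <;> simp [e1, e2]
  have hw : 0 < |wd s v| := abs_pos.2 hv
  refine Rate.of_bounds ?_ hs
  intro ε hε
  have hv0 : ∀ n, 0 < ‖A n v‖ := fun n => norm_pos_iff.2 (map_ne_of_dt (h.dt0 n) (by
    rintro rfl; exact hv (by simp [wd])))
  filter_upwards [(h.rate_fast hs hv).le hv0 (ε := ε/4) (by linarith), h.rd.ge hdp (ε := ε/4) (by linarith),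
      ev_const (2 / |wd s v|) (ε := ε/2) (by linarith)] with n h1 h2 h3
  have h4 : |dt (A n)| * |wd s v| ≤ 2 * ‖A n s‖ * ‖A n v‖ := by
    rw [← abs_mul, ← wd_map]; exact abs_wd_le _ _
  rw [div_le_iff₀ hw] at h3
  have h5 : Real.exp (n * (d - ε/4)) * |wd s v| ≤ 2 * ‖A n s‖ * Real.exp (n * (l + ε/4)) :=
    calc _ ≤ |dt (A n)| * |wd s v| := by gcongr
      _ ≤ _ := h4
      _ ≤ _ := by gcongr
  have h6 : 2 * Real.exp (n * (d - ε/4)) ≤ Real.exp (n * (ε/2)) * (2 * ‖A n s‖ * Real.exp (n * (l + ε/4))) := 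
    calc 2 * Real.exp (n * (d - ε/4)) ≤ (Real.exp (n * (ε/2)) * |wd s v|) * Real.exp (n * (d - ε/4)) := by gcongr
      _ = Real.exp (n * (ε/2)) * (Real.exp (n * (d - ε/4)) * |wd s v|) := by ring
      _ ≤ _ := by gcongr
  have h7 : Real.exp (n * (d - ε/4)) = Real.exp (n * (ε/2)) * Real.exp (n * (l + ε/4)) * Real.exp (n * (d - l - ε)) := by
    rw [← Real.exp_add, ← Real.exp_add]; congr 1; ring
  rw [h7] at h6
  refine le_of_mul_le_mul_left ?_ (by positivity : 0 < 2 * (Real.exp (n * (ε/2)) * Real.exp (n * (l + ε/4))))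
  linarith

/-- Slow directions are unique. -/
lemma PW.slow_unique {A : ℕ → P2 →L[ℝ] P2} {l d L : ℝ} (h : PW A l d L) {s v : P2}
    (hs : Slow A (d - l) s) (χ : ℝ) (hχ : χ < l)
    (hv : ∃ᶠ n : ℕ in atTop, ‖A n v‖ ≤ Real.exp (n * χ)) : wd s v = 0 := by
  by_contra hne
  have hv0 : ∀ n, 0 < ‖A n v‖ := fun n => norm_pos_iff.2 (map_ne_of_dt (h.dt0 n) (by
    rintro rfl; exact hne (by simp [wd])))
  have h1 := (h.rate_fast hs hne).ge hv0 (ε := (l - χ)/2) (by linarith)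
  obtain ⟨n, ⟨hn, hn1⟩, hn2⟩ := ((hv.and_eventually h1).and_eventually (eventually_gt_atTop 0)).exists
  have h2 := Real.exp_le_exp.1 (hn1.trans hn)
  have h3 : (0:ℝ) < n := by exact_mod_cast hn2
  nlinarith

lemma eq_smul_of_wd {s v : P2} (hs : s ≠ 0) (h : wd s v = 0) : ∃ c : ℝ, v = c • s := by
  have h' : s.1 * v.2 = s.2 * v.1 := by unfold wd at h; linarith
  by_cases h1 : s.1 = 0
  · have h2 : s.2 ≠ 0 := fun h2 => hs (by ext <;> simp [h1, h2])
    refine ⟨v.2 / s.2, ?_⟩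
    have : v.1 = 0 := by
      rw [h1, zero_mul] at h'
      exact (mul_eq_zero.1 h'.symm).resolve_left h2
    ext
    · simp [h1, this]
    · simp; field_simp
  · refine ⟨v.1 / s.1, ?_⟩
    ext
    · simp; field_simp
    · simp; field_simp; linarith


structure Sys (f g : P2 → P2) (μ : Measure P2) (S : Set P2) : Prop where
  hf : ContDiff ℝ 2 f
  hg : ContDiff ℝ 2 g
  gf : ∀ x, g (f x) = x
  fg : ∀ x, f (g x) = x
  erg : Ergodic f μ
  ergg : Ergodic g μ
  cpt : IsCompact S
  inv : ∀ x, f x ∈ S ↔ x ∈ S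
  full : ∀ᵐ x ∂μ, x ∈ S

section sys
variable {f g : P2 → P2} {μ : Measure P2} {S : Set P2}

lemma Sys.symm (h : Sys f g μ S) : Sys g f μ S :=
  ⟨h.hg, h.hf, h.fg, h.gf, h.ergg, h.erg, h.cpt, fun x => by rw [← h.inv, h.fg], h.full⟩

lemma Sys.inv_iter (h : Sys f g μ S) (n : ℕ) (x : P2) : f^[n] x ∈ S ↔ x ∈ S := by
  induction n generalizing x with
  | zero => simp
  | succ n ih => rw [Function.iterate_succ_apply, ih, h.inv]

lemma Sys.giter (h : Sys f g μ S) (n : ℕ) (x : P2) : g^[n] (f^[n] x) = x :=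
  (Function.LeftInverse.iterate h.gf n) x

lemma Sys.cd (h : Sys f g μ S) (n : ℕ) : ContDiff ℝ 2 (f^[n]) := by
  induction n with
  | zero => exact contDiff_id
  | succ n ih => rw [Function.iterate_succ]; exact ih.comp h.hf

lemma Sys.diff (h : Sys f g μ S) (n : ℕ) : Differentiable ℝ (f^[n]) :=
  (h.cd n).differentiable (by norm_num)

lemma Sys.chain (h : Sys f g μ S) (m n : ℕ) (x : P2) :
    fderiv ℝ (f^[m + n]) x = (fderiv ℝ (f^[n]) (f^[m] x)).comp (fderiv ℝ (f^[m]) x) := by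
  rw [add_comm, Function.iterate_add]
  exact fderiv_comp x (h.diff n _) (h.diff m _)

lemma Sys.ginv (h : Sys f g μ S) (n : ℕ) (x : P2) :
    (fderiv ℝ (g^[n]) (f^[n] x)).comp (fderiv ℝ (f^[n]) x) = ContinuousLinearMap.id ℝ P2 := by
  rw [← fderiv_comp x (h.symm.diff n _) (h.diff n _)]
  have : g^[n] ∘ f^[n] = id := by ext1 y; exact h.giter n y
  rw [this, fderiv_id]

lemma dt_comp (A B : P2 →L[ℝ] P2) : dt (A.comp B) = dt A * dt B := by
  unfold dt
  rw [← LinearMap.det_comp]; rfl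

lemma dt_id : dt (ContinuousLinearMap.id ℝ P2) = 1 := by
  rw [dt_eq]; simp [wd]

lemma Sys.dt_inv (h : Sys f g μ S) (n : ℕ) (x : P2) :
    dt (fderiv ℝ (g^[n]) (f^[n] x)) * dt (fderiv ℝ (f^[n]) x) = 1 := by
  rw [← dt_comp, h.ginv, dt_id]

lemma Sys.dt_ne (h : Sys f g μ S) (n : ℕ) (x : P2) : dt (fderiv ℝ (f^[n]) x) ≠ 0 := by
  intro h0
  have := h.dt_inv n x
  rw [h0, mul_zero] at this
  exact zero_ne_one this

lemma Sys.exists_bound (h : Sys f g μ S) :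
    ∃ M, 0 ≤ M ∧ ∀ x ∈ S, ‖fderiv ℝ f x‖ ≤ Real.exp M ∧ ‖fderiv ℝ g x‖ ≤ Real.exp M := by
  obtain ⟨a, ha⟩ := h.cpt.exists_bound_of_continuousOn (f := fderiv ℝ f)
    (h.hf.continuous_fderiv (by norm_num)).continuousOn
  obtain ⟨b, hb⟩ := h.cpt.exists_bound_of_continuousOn (f := fderiv ℝ g)
    (h.hg.continuous_fderiv (by norm_num)).continuousOn
  refine ⟨|a| + |b|, by positivity, fun x hx => ⟨?_, ?_⟩⟩
  · have h1 := ha x hx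
    have := Real.add_one_le_exp (|a| + |b|)
    have := le_abs_self a
    have := abs_nonneg b
    linarith
  · have h1 := hb x hx
    have := Real.add_one_le_exp (|a| + |b|)
    have := le_abs_self b
    have := abs_nonneg a
    linarith

lemma Sys.norm_iter_le (h : Sys f g μ S) {M : ℝ} (hM : ∀ x ∈ S, ‖fderiv ℝ f x‖ ≤ Real.exp M)
    (n : ℕ) : ∀ x ∈ S, ‖fderiv ℝ (f^[n]) x‖ ≤ Real.exp (M * n) := by
  induction n with
  | zero => intro x _; simp
  | succ n ih =>
    intro x hx
    rw [h.chain n 1 x]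
    refine (ContinuousLinearMap.opNorm_comp_le _ _).trans ?_
    have h1 := hM (f^[n] x) ((h.inv_iter n x).2 hx)
    have h2 := ih x hx
    rw [Function.iterate_one]
    calc _ ≤ Real.exp M * Real.exp (M * n) := by gcongr
      _ = _ := by rw [← Real.exp_add]; congr 1; push_cast; ring

lemma abs_dt_le (A : P2 →L[ℝ] P2) : |dt A| ≤ 2 * ‖A‖ ^ 2 := by
  rw [dt_eq]
  refine (abs_wd_le _ _).trans ?_
  have h1 : ‖A (1, 0)‖ ≤ ‖A‖ := by simpa using A.le_opNorm (1, 0)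
  have h2 : ‖A (0, 1)‖ ≤ ‖A‖ := by simpa using A.le_opNorm (0, 1)
  nlinarith [norm_nonneg A, mul_le_mul h1 h2 (norm_nonneg _) (norm_nonneg _)]

lemma Sys.dt_iter_le (h : Sys f g μ S) {c : ℝ} (hc : ∀ x ∈ S, |dt (fderiv ℝ f x)| ≤ Real.exp c)
    (n : ℕ) : ∀ x ∈ S, |dt (fderiv ℝ (f^[n]) x)| ≤ Real.exp (c * n) := by
  induction n with
  | zero =>
    intro x _
    have : fderiv ℝ (f^[0]) x = ContinuousLinearMap.id ℝ P2 := by simp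
    rw [this, dt_id]; simp
  | succ n ih =>
    intro x hx
    rw [h.chain n 1 x, dt_comp, abs_mul]
    have h1 := hc (f^[n] x) ((h.inv_iter n x).2 hx)
    have h2 := ih x hx
    rw [Function.iterate_one]
    calc _ ≤ Real.exp c * Real.exp (c * n) := by gcongr
      _ = _ := by rw [← Real.exp_add]; congr 1; push_cast; ring

/-- bounds for the logarithms -/
lemma Sys.log_bounds (h : Sys f g μ S) :
    ∃ M, 0 ≤ M ∧ (∀ x ∈ S, ‖fderiv ℝ f x‖ ≤ Real.exp M ∧ ‖fderiv ℝ g x‖ ≤ Real.exp M) ∧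
      ∀ n : ℕ, ∀ x ∈ S, |Real.log ‖fderiv ℝ (f^[n]) x‖| ≤ M * n ∧
        |Real.log (|dt (fderiv ℝ (f^[n]) x)|)| ≤ M * n := by
  obtain ⟨M, hM0, hM⟩ := h.exists_bound
  set c := Real.log 2 + 2 * M with hcd
  have hl2 : 0 < Real.log 2 := Real.log_pos (by norm_num)
  have hce : Real.exp c = 2 * Real.exp M ^ 2 := by
    rw [hcd, Real.exp_add, Real.exp_log (by norm_num), ← Real.exp_nat_mul]; norm_num
  have hcf : ∀ x ∈ S, |dt (fderiv ℝ f x)| ≤ Real.exp c := fun x hx => by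
    rw [hce]
    refine (abs_dt_le _).trans ?_
    have := (hM x hx).1
    gcongr
  have hcg : ∀ x ∈ S, |dt (fderiv ℝ g x)| ≤ Real.exp c := fun x hx => by
    rw [hce]
    refine (abs_dt_le _).trans ?_
    have := (hM x hx).2
    gcongr
  have hMc : M ≤ c := by linarith
  have hMce : Real.exp M ≤ Real.exp c := Real.exp_le_exp.2 hMc
  refine ⟨c, by positivity, fun x hx => ⟨(hM x hx).1.trans hMce, (hM x hx).2.trans hMce⟩,
    fun n x hx => ⟨?_, ?_⟩⟩
  · have h1 := h.norm_iter_le (fun x hx => (hM x hx).1.trans hMce) n x hx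
    have h2 := h.symm.norm_iter_le (fun x hx => (hM x hx).2.trans hMce) n (f^[n] x)
      ((h.inv_iter n x).2 hx)
    have hp := norm_pos_of_dt (h.dt_ne n x)
    have h3 : 1 ≤ ‖fderiv ℝ (g^[n]) (f^[n] x)‖ * ‖fderiv ℝ (f^[n]) x‖ := by
      have := ContinuousLinearMap.opNorm_comp_le (fderiv ℝ (g^[n]) (f^[n] x)) (fderiv ℝ (f^[n]) x)
      rw [h.ginv] at this
      simpa using this
    rw [abs_le]
    constructor
    · rw [Real.le_log_iff_exp_le hp, Real.exp_neg]
      rw [inv_le_iff_one_le_mul₀ (Real.exp_pos _)]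
      refine h3.trans ?_
      rw [mul_comm]
      gcongr
    · rwa [Real.log_le_iff_le_exp hp]
  · have h1 := h.dt_iter_le hcf n x hx
    have h2 := h.symm.dt_iter_le hcg n (f^[n] x) ((h.inv_iter n x).2 hx)
    have hp : 0 < |dt (fderiv ℝ (f^[n]) x)| := abs_pos.2 (h.dt_ne n x)
    have h3 : |dt (fderiv ℝ (g^[n]) (f^[n] x))| * |dt (fderiv ℝ (f^[n]) x)| = 1 := by
      rw [← abs_mul, h.dt_inv, abs_one]
    rw [abs_le]
    constructor
    · rw [Real.le_log_iff_exp_le hp, Real.exp_neg]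
      rw [inv_le_iff_one_le_mul₀ (Real.exp_pos _)]
      refine h3.symm.le.trans ?_
      rw [mul_comm]
      gcongr
    · rwa [Real.log_le_iff_le_exp hp]

lemma Sys.meas_norm (h : Sys f g μ S) (n : ℕ) :
    Measurable fun x => Real.log ‖fderiv ℝ (f^[n]) x‖ :=
  Real.measurable_log.comp ((h.cd n).continuous_fderiv (by norm_num)).norm.measurable

lemma Sys.cont_dt (h : Sys f g μ S) (n : ℕ) :
    Continuous fun x => dt (fderiv ℝ (f^[n]) x) := by
  have hc := (h.cd n).continuous_fderiv (by norm_num)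
  have h1 : Continuous fun x => fderiv ℝ (f^[n]) x (1, 0) := hc.clm_apply continuous_const
  have h2 : Continuous fun x => fderiv ℝ (f^[n]) x (0, 1) := hc.clm_apply continuous_const
  simp only [dt_eq, wd]
  fun_prop

lemma Sys.meas_dt (h : Sys f g μ S) (n : ℕ) :
    Measurable fun x => Real.log |dt (fderiv ℝ (f^[n]) x)| :=
  Real.measurable_log.comp (h.cont_dt n).abs.measurable

variable [IsProbabilityMeasure μ]

structure Exps (f : P2 → P2) (μ : Measure P2) (l d : ℝ) : Prop where
  rl : ∀ᵐ x ∂μ, Rate (fun n => ‖fderiv ℝ (f^[n]) x‖) l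
  rd : ∀ᵐ x ∂μ, Rate (fun n => |dt (fderiv ℝ (f^[n]) x)|) d
  il : Tendsto (fun n : ℕ => (∫ x, Real.log ‖fderiv ℝ (f^[n]) x‖ ∂μ) / n) atTop (nhds l)
  id : Tendsto (fun n : ℕ => (∫ x, Real.log |dt (fderiv ℝ (f^[n]) x)| ∂μ) / n) atTop (nhds d)

lemma Sys.exists_exps (h : Sys f g μ S) : ∃ l d, Exps f μ l d := by
  obtain ⟨M, hM0, -, hM⟩ := h.log_bounds
  have hSm := h.cpt.isClosed.measurableSet
  obtain ⟨l, l1, l2⟩ := kingman_on (a := fun n x => Real.log ‖fderiv ℝ (f^[n]) x‖) h.erg S hSm h.inv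
    h.full hM0 h.meas_norm (fun n x hx => (hM n x hx).1) (fun m n x hx => by
      rw [h.chain, ← Real.log_mul (norm_pos_of_dt (h.dt_ne _ _)).ne' (norm_pos_of_dt (h.dt_ne _ _)).ne']
      apply Real.log_le_log
      · apply norm_pos_of_dt
        rw [dt_comp]
        exact mul_ne_zero (h.dt_ne _ _) (h.dt_ne _ _)
      · rw [mul_comm]; exact ContinuousLinearMap.opNorm_comp_le _ _)
  obtain ⟨d, d1, d2⟩ := kingman_on (a := fun n x => Real.log |dt (fderiv ℝ (f^[n]) x)|) h.erg S hSm h.inv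
    h.full hM0 h.meas_dt (fun n x hx => (hM n x hx).2) (fun m n x hx => by
      rw [h.chain, dt_comp, abs_mul, Real.log_mul (abs_pos.2 (h.dt_ne _ _)).ne' (abs_pos.2 (h.dt_ne _ _)).ne',
        add_comm])
  exact ⟨l, d, l1, d1, l2, d2⟩

lemma norm_le_wd (u : P2) (c : ℝ) (h1 : |wd u (1, 0)| ≤ c) (h2 : |wd u (0, 1)| ≤ c) : ‖u‖ ≤ c := by
  simp [wd] at h1 h2
  exact max_le h2 h1

lemma norm_inv_le (A B : P2 →L[ℝ] P2) (hAB : A.comp B = ContinuousLinearMap.id ℝ P2) :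
    ‖B‖ * |dt A| ≤ 4 * ‖A‖ := by
  have key : ∀ i k : P2, ‖i‖ ≤ 1 → ‖k‖ ≤ 1 → |wd (B i) k| * |dt A| ≤ 2 * ‖A‖ := by
    intro i k hi hk
    have h1 : wd i (A k) = dt A * wd (B i) k := by
      rw [← wd_map]
      congr 1
      exact (congrArg (fun T : P2 →L[ℝ] P2 => T i) hAB).symm
    rw [← abs_mul, mul_comm, ← h1]
    refine (abs_wd_le _ _).trans ?_
    have h2 := A.le_opNorm k
    have h3 : ‖A k‖ ≤ ‖A‖ := h2.trans (by nlinarith [norm_nonneg A])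
    nlinarith [norm_nonneg A, norm_nonneg i, norm_nonneg (A k)]
  have n1 : ‖((1, 0) : P2)‖ ≤ 1 := by simp
  have n2 : ‖((0, 1) : P2)‖ ≤ 1 := by simp
  have hA : dt A ≠ 0 := by
    intro h0
    have := dt_comp A B
    rw [hAB, dt_id, h0, zero_mul] at this
    exact one_ne_zero this
  have hp : 0 < |dt A| := abs_pos.2 hA
  rw [← le_div_iff₀ hp]
  have : 4 * ‖A‖ / |dt A| = 2 * (2 * ‖A‖ / |dt A|) := by ring
  rw [this]
  apply opnorm_le
  · apply norm_le_wd
    · rw [le_div_iff₀ hp]; exact key _ _ n1 n1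
    · rw [le_div_iff₀ hp]; exact key _ _ n1 n2
  · apply norm_le_wd
    · rw [le_div_iff₀ hp]; exact key _ _ n2 n1
    · rw [le_div_iff₀ hp]; exact key _ _ n2 n2

lemma Sys.log_inv (h : Sys f g μ S) (n : ℕ) (x : P2) :
    Real.log |dt (fderiv ℝ (g^[n]) (f^[n] x))| = - Real.log |dt (fderiv ℝ (f^[n]) x)| := by
  rw [eq_neg_iff_add_eq_zero, ← Real.log_mul (abs_pos.2 (h.symm.dt_ne _ _)).ne'
    (abs_pos.2 (h.dt_ne _ _)).ne', ← abs_mul, h.dt_inv]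
  simp

lemma Sys.log_norm_inv (h : Sys f g μ S) (n : ℕ) (x : P2) :
    |Real.log ‖fderiv ℝ (g^[n]) (f^[n] x)‖ -
      (Real.log ‖fderiv ℝ (f^[n]) x‖ - Real.log |dt (fderiv ℝ (f^[n]) x)|)| ≤ Real.log 4 := by
  have h1 := norm_inv_le _ _ (h.ginv n x)
  have h2 : (fderiv ℝ (f^[n]) x).comp (fderiv ℝ (g^[n]) (f^[n] x)) = ContinuousLinearMap.id ℝ P2 := by
    have := h.symm.ginv n (f^[n] x)
    rwa [h.giter n x] at this
  have h3 := norm_inv_le _ _ h2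
  have p1 := norm_pos_of_dt (h.dt_ne n x)
  have p2 := norm_pos_of_dt (h.symm.dt_ne n (f^[n] x))
  have p3 : 0 < |dt (fderiv ℝ (f^[n]) x)| := abs_pos.2 (h.dt_ne _ _)
  have p4 : 0 < |dt (fderiv ℝ (g^[n]) (f^[n] x))| := abs_pos.2 (h.symm.dt_ne _ _)
  have e1 := Real.log_le_log (by positivity) h1
  have e3 := Real.log_le_log (by positivity) h3
  rw [Real.log_mul (by positivity) (by positivity), Real.log_mul (by positivity) (by positivity)] at e1 e3
  rw [h.log_inv] at e1
  rw [abs_le]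
  constructor <;> linarith

lemma Sys.integral_iter (h : Sys f g μ S) (n : ℕ) (φ : P2 → ℝ) (hφ : Measurable φ) :
    ∫ x, φ (f^[n] x) ∂μ = ∫ x, φ x ∂μ := by
  have hm := h.erg.toMeasurePreserving.iterate n
  have := integral_map (μ := μ) hm.measurable.aemeasurable (f := φ) hφ.aestronglyMeasurable
  rw [hm.map_eq] at this
  exact this.symm

lemma Sys.exps_symm (h : Sys f g μ S) {l d l' d' : ℝ} (e : Exps f μ l d) (e' : Exps g μ l' d') :
    d' = -d ∧ l' = l - d := by
  obtain ⟨M, hM0, -, hM⟩ := h.log_bounds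
  have i1 : ∀ n : ℕ, Integrable (fun x => Real.log ‖fderiv ℝ (f^[n]) x‖) μ := fun n =>
    Integrable.of_bound (h.meas_norm n).aestronglyMeasurable (M * n) (by
      filter_upwards [h.full] with x hx using (hM n x hx).1)
  have i2 : ∀ n : ℕ, Integrable (fun x => Real.log |dt (fderiv ℝ (f^[n]) x)|) μ := fun n =>
    Integrable.of_bound (h.meas_dt n).aestronglyMeasurable (M * n) (by
      filter_upwards [h.full] with x hx using (hM n x hx).2)
  obtain ⟨M', hM0', -, hM'⟩ := h.symm.log_bounds
  have i3 : ∀ n : ℕ, Integrable (fun x => Real.log ‖fderiv ℝ (g^[n]) (f^[n] x)‖) μ := fun n =>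
    (h.erg.toMeasurePreserving.iterate n).integrable_comp_of_integrable
    (Integrable.of_bound (h.symm.meas_norm n).aestronglyMeasurable (M' * n) (by
      filter_upwards [h.full] with x hx using (hM' n x hx).1))
  constructor
  · refine tendsto_nhds_unique e'.id (e.id.neg.congr fun n => ?_)
    rw [← h.integral_iter n _ (h.symm.meas_dt n)]
    simp only [h.log_inv]
    rw [integral_neg, neg_div]
  · have hlim : Tendsto (fun n : ℕ => (∫ x, Real.log ‖fderiv ℝ (g^[n]) x‖ ∂μ) / n -
        ((∫ x, Real.log ‖fderiv ℝ (f^[n]) x‖ ∂μ) / n - (∫ x, Real.log |dt (fderiv ℝ (f^[n]) x)| ∂μ) / n))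
        atTop (nhds (l' - (l - d))) := e'.il.sub (e.il.sub e.id)
    have h0 : Tendsto (fun n : ℕ => (∫ x, Real.log ‖fderiv ℝ (g^[n]) x‖ ∂μ) / n -
        ((∫ x, Real.log ‖fderiv ℝ (f^[n]) x‖ ∂μ) / n - (∫ x, Real.log |dt (fderiv ℝ (f^[n]) x)| ∂μ) / n))
        atTop (nhds 0) := by
      refine squeeze_zero_norm (a := fun n : ℕ => Real.log 4 / n) (fun n => ?_)
        (tendsto_const_div_atTop_nhds_zero_nat _)
      have i4 : Integrable (fun x => Real.log ‖fderiv ℝ (f^[n]) x‖ - Real.log |dt (fderiv ℝ (f^[n]) x)|) μ :=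
        (i1 n).sub (i2 n)
      rw [← h.integral_iter n _ (h.symm.meas_norm n), ← sub_div, ← sub_div,
        ← integral_sub (i1 n) (i2 n), ← integral_sub (i3 n) i4]
      rw [norm_div, Real.norm_natCast]
      gcongr
      refine (norm_integral_le_of_norm_le_const (C := Real.log 4) (Eventually.of_forall fun x => ?_)).trans ?_
      · exact h.log_norm_inv n x
      · simp
    have := tendsto_nhds_unique hlim h0
    linarith

lemma Sys.ae_pw (h : Sys f g μ S) {l d : ℝ} (e : Exps f μ l d) (hgap : d < 2 * l) :
    ∃ L, ∀ᵐ x ∂μ, PW (fun n => fderiv ℝ (f^[n]) x) l d L := by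
  obtain ⟨M, hM0, hM, -⟩ := h.log_bounds
  refine ⟨Real.exp M, ?_⟩
  filter_upwards [e.rl, e.rd, h.full] with x h1 h2 hx
  refine ⟨fun n => h.dt_ne n x, Real.exp_pos _, fun n v => ?_, h1, h2, hgap⟩
  have hxn : f^[n+1] x ∈ S := (h.inv_iter _ _).2 hx
  have h3 : fderiv ℝ g (f^[n+1] x) (fderiv ℝ (f^[n+1]) x v) = fderiv ℝ (f^[n]) x v := by
    have e1 := h.ginv 1 (f^[n] x)
    rw [Function.iterate_one, Function.iterate_one] at e1
    have e2 := h.chain n 1 x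
    rw [Function.iterate_one] at e2
    rw [e2, Function.iterate_succ_apply']
    exact congrArg (fun T : P2 →L[ℝ] P2 => T (fderiv ℝ (f^[n]) x v)) e1
  rw [← h3]
  refine (ContinuousLinearMap.le_opNorm _ _).trans ?_
  have := (hM _ hxn).2
  gcongr

end sys


section sys2
variable {f g : P2 → P2} {μ : Measure P2} {S : Set P2}

lemma circ_compact : IsCompact {v : P2 | v.1 ^ 2 + v.2 ^ 2 = 1} := by
  apply Metric.isCompact_of_isClosed_isBounded
  · exact isClosed_eq (by fun_prop) continuous_const
  · refine (Metric.isBounded_closedBall (x := (0:P2)) (r := 1)).subset fun v hv => ?_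
    simp only [Set.mem_ofPred_eq] at hv
    rw [mem_closedBall_zero_iff]
    apply max_le
    · simp only [Real.norm_eq_abs]
      apply abs_le_of_sq_le_sq _ zero_le_one
      nlinarith [sq_nonneg v.2]
    · simp only [Real.norm_eq_abs]
      apply abs_le_of_sq_le_sq _ zero_le_one
      nlinarith [sq_nonneg v.1]

lemma circ_norm {v : P2} (hv : v.1 ^ 2 + v.2 ^ 2 = 1) : 1 / 2 < ‖v‖ := by
  by_contra! hc
  have h1 : |v.1| ≤ 1 / 2 := (norm_fst_le v).trans hc
  have h2 : |v.2| ≤ 1 / 2 := (norm_snd_le v).trans hc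
  have h3 := sq_le_sq' (abs_le.1 h1).1 (abs_le.1 h1).2
  have h4 := sq_le_sq' (abs_le.1 h2).1 (abs_le.1 h2).2
  linarith

lemma Slow.smul {A : ℕ → P2 →L[ℝ] P2} {χ : ℝ} {v : P2} (h : Slow A χ v) (c : ℝ) :
    Slow A χ (c • v) := by
  intro ε hε
  filter_upwards [h (ε/2) (by linarith), ev_const |c| (ε := ε/2) (by linarith)] with n h1 h2
  rw [map_smul, norm_smul, Real.norm_eq_abs]
  calc |c| * ‖A n v‖ ≤ Real.exp (n * (ε/2)) * Real.exp (n * (χ + ε/2)) := by gcongr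
    _ = _ := by rw [← Real.exp_add]; congr 1; ring

lemma exists_unit {s : P2} (hs : s ≠ 0) : ∃ c : ℝ, (c • s).1 ^ 2 + (c • s).2 ^ 2 = 1 := by
  have hp : 0 < s.1 ^ 2 + s.2 ^ 2 := by
    by_contra! hc
    apply hs
    have h1 : s.1 = 0 := by nlinarith [sq_nonneg s.1, sq_nonneg s.2]
    have h2 : s.2 = 0 := by nlinarith [sq_nonneg s.1, sq_nonneg s.2]
    ext <;> simp [h1, h2]
  refine ⟨(Real.sqrt (s.1 ^ 2 + s.2 ^ 2))⁻¹, ?_⟩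
  simp only [Prod.smul_fst, Prod.smul_snd, smul_eq_mul, mul_pow, inv_pow, Real.sq_sqrt hp.le]
  field_simp

lemma circ_ne {s : P2} (h : s.1 ^ 2 + s.2 ^ 2 = 1) : s ≠ 0 := by
  rintro rfl; simp at h

def Bad (f g : P2 → P2) (S : Set P2) (a b : ℝ) (N : ℕ) : Set P2 :=
  {x | x ∈ S ∧ ∃ v : P2, v.1 ^ 2 + v.2 ^ 2 = 1 ∧ ∀ n : ℕ, N ≤ n →
    ‖fderiv ℝ (f^[n]) x v‖ ≤ Real.exp (n * a) ∧ ‖fderiv ℝ (g^[n]) x v‖ ≤ Real.exp (n * b)}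

lemma Sys.bad_meas (h : Sys f g μ S) (a b : ℝ) (N : ℕ) : MeasurableSet (Bad f g S a b N) := by
  have hcl : IsClosed {p : P2 × P2 | ∀ n : ℕ, N ≤ n →
    ‖fderiv ℝ (f^[n]) p.1 p.2‖ ≤ Real.exp (n * a) ∧ ‖fderiv ℝ (g^[n]) p.1 p.2‖ ≤ Real.exp (n * b)} := by
    have : {p : P2 × P2 | ∀ n : ℕ, N ≤ n →
      ‖fderiv ℝ (f^[n]) p.1 p.2‖ ≤ Real.exp (n * a) ∧ ‖fderiv ℝ (g^[n]) p.1 p.2‖ ≤ Real.exp (n * b)}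
      = ⋂ n : ℕ, ⋂ _ : N ≤ n, ({p : P2 × P2 | ‖fderiv ℝ (f^[n]) p.1 p.2‖ ≤ Real.exp (n * a)} ∩
        {p : P2 × P2 | ‖fderiv ℝ (g^[n]) p.1 p.2‖ ≤ Real.exp (n * b)}) := by
      ext p; simp
    rw [this]
    refine isClosed_iInter fun n => isClosed_iInter fun _ => IsClosed.inter ?_ ?_
    · exact isClosed_le ((h.cd n).continuous_fderiv_apply (by norm_num)).norm continuous_const
    · exact isClosed_le ((h.symm.cd n).continuous_fderiv_apply (by norm_num)).norm continuous_const
  have hc := ((h.cpt.prod circ_compact).inter_right hcl).image continuous_fst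
  have heq : Bad f g S a b N = Prod.fst '' ((S ×ˢ {v : P2 | v.1 ^ 2 + v.2 ^ 2 = 1}) ∩
    {p : P2 × P2 | ∀ n : ℕ, N ≤ n →
    ‖fderiv ℝ (f^[n]) p.1 p.2‖ ≤ Real.exp (n * a) ∧ ‖fderiv ℝ (g^[n]) p.1 p.2‖ ≤ Real.exp (n * b)}) := by
    ext x
    constructor
    · rintro ⟨hx, v, hv, hn⟩
      exact ⟨(x, v), ⟨⟨hx, hv⟩, hn⟩, rfl⟩
    · rintro ⟨⟨y, v⟩, ⟨⟨hx, hv⟩, hn⟩, rfl⟩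
      exact ⟨hx, v, hv, hn⟩
  rw [heq]
  exact hc.isClosed.measurableSet

lemma Sys.transv (h : Sys f g μ S) [IsProbabilityMeasure μ] {l d : ℝ} (e : Exps f μ l d)
    (hgap : d < 2 * l) :
    ∀ᵐ x ∂μ, ∀ s u : P2, s ≠ 0 → u ≠ 0 → Slow (fun n => fderiv ℝ (f^[n]) x) (d - l) s →
      Slow (fun n => fderiv ℝ (g^[n]) x) (-l) u → wd s u ≠ 0 := by
  obtain ⟨L, hpw⟩ := h.ae_pw e hgap
  set ε := (2 * l - d) / 4 with hε
  have hε0 : 0 < ε := by rw [hε]; linarith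
  have hall : ∀ᵐ x ∂μ, ∀ n : ℕ, PW (fun k => fderiv ℝ (f^[k]) (f^[n] x)) l d L :=
    ae_all_iff.2 fun n => (h.erg.toMeasurePreserving.iterate n).quasiMeasurePreserving.ae hpw
  have hrec : ∀ᵐ x ∂μ, ∀ N : ℕ, x ∈ Bad f g S (d - l + ε) (-l + ε) N →
      ∃ᶠ n in atTop, f^[n] x ∈ Bad f g S (d - l + ε) (-l + ε) N :=
    ae_all_iff.2 fun N => h.erg.toMeasurePreserving.conservative.ae_mem_imp_frequently_image_mem
      (h.bad_meas _ _ N).nullMeasurableSet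
  filter_upwards [hall, hrec, h.full] with x hx hxr hxS s u hs0 hu0 hs hu hw
  obtain ⟨c, rfl⟩ := eq_smul_of_wd hs0 hw
  have hc0 : c ≠ 0 := by rintro rfl; simp at hu0
  obtain ⟨r, hr⟩ := exists_unit hs0
  have hs1 := hs.smul r ε hε0
  have hu1 := hu.smul (r * c⁻¹) ε hε0
  rw [smul_smul, mul_assoc, inv_mul_cancel₀ hc0, mul_one] at hu1
  obtain ⟨N, hN⟩ := eventually_atTop.1 (hs1.and hu1)
  have hxB : x ∈ Bad f g S (d - l + ε) (-l + ε) N := ⟨hxS, r • s, hr, fun n hn => hN n hn⟩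
  obtain ⟨n, ⟨⟨hyS, w, hw1, hwN⟩, hn2⟩, hnN⟩ := (((hxr N hxB).and_eventually
    (ev_const 5 (ε := 2 * ε) (by linarith))).and_eventually (eventually_ge_atTop N)).exists
  have pw := hx n
  obtain ⟨t, ht1, ht⟩ := pw.exists_slow
  have w1 : wd t w = 0 := by
    refine pw.slow_unique ht (d - l + ε) (by rw [hε]; linarith) (Eventually.frequently ?_)
    filter_upwards [eventually_ge_atTop N] with m hm using (hwN m hm).1
  set q := fderiv ℝ (f^[n]) x (r • s) with hq
  have w2 : wd t q = 0 := by
    refine pw.slow_unique ht (d - l + 2 * ε) (by rw [hε]; linarith) (Eventually.frequently ?_)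
    filter_upwards [eventually_ge_atTop N, ev_const (Real.exp (n * (d - l + ε))) hε0] with m hm hm2
    have e1 := (hN (n + m) (by omega)).1
    beta_reduce at e1
    rw [h.chain] at e1
    refine e1.trans ?_
    calc Real.exp (((n + m : ℕ) : ℝ) * (d - l + ε)) = Real.exp (n * (d - l + ε)) * Real.exp (m * (d - l + ε)) := by
          rw [← Real.exp_add]; congr 1; push_cast; ring
      _ ≤ Real.exp (m * ε) * Real.exp (m * (d - l + ε)) := by gcongr
      _ = _ := by rw [← Real.exp_add]; congr 1; ring
  obtain ⟨c1, e1⟩ := eq_smul_of_wd (circ_ne ht1) w1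
  obtain ⟨c2, e2⟩ := eq_smul_of_wd (circ_ne ht1) w2
  have hq0 : q ≠ 0 := map_ne_of_dt (h.dt_ne n x) (circ_ne hr)
  have hc2 : c2 ≠ 0 := by rintro rfl; rw [zero_smul] at e2; exact hq0 e2
  have hwq : w = (c1 / c2) • q := by rw [e1, e2, smul_smul, div_mul_cancel₀ _ hc2]
  have hgw : fderiv ℝ (g^[n]) (f^[n] x) w = (c1 / c2) • (r • s) := by
    rw [hwq, map_smul, hq]
    congr 1
    exact congrArg (fun T : P2 →L[ℝ] P2 => T (r • s)) (h.ginv n x)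
  have b1 := (hwN n hnN).2
  have b2 := (hN n hnN).1
  rw [hgw, norm_smul] at b1
  have b3 : ‖w‖ = ‖c1 / c2‖ * ‖q‖ := by rw [hwq, norm_smul]
  have b4 := circ_norm hw1
  have b5 := circ_norm hr
  have b6 : ‖w‖ * ‖r • s‖ ≤ Real.exp (n * (-l + ε)) * Real.exp (n * (d - l + ε)) := by
    calc _ = (‖c1 / c2‖ * ‖r • s‖) * ‖q‖ := by rw [b3]; ring
      _ ≤ _ := by gcongr
  have b7 : (Real.exp (n * (-l + ε)) * Real.exp (n * (d - l + ε))) * Real.exp (n * (2 * ε)) = 1 := by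
    rw [← Real.exp_add, ← Real.exp_add, Real.exp_eq_one_iff, hε]; ring
  have b8 : 1 / 4 ≤ ‖w‖ * ‖r • s‖ := by nlinarith
  have b9 := b8.trans b6
  nlinarith

end sys2


section sys3
variable {f g : P2 → P2} {μ : Measure P2} {S : Set P2}

lemma lip_ball {F : P2 → P2} (hF : ContDiff ℝ 2 F) (R : ℝ) :
    ∃ E : ℝ, 1 ≤ E ∧ ∀ y ∈ Metric.closedBall (0:P2) R, ∀ z ∈ Metric.closedBall (0:P2) R,
      ‖F y - F z‖ ≤ E * ‖y - z‖ := by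
  obtain ⟨a, ha⟩ := (isCompact_closedBall (0:P2) R).exists_bound_of_continuousOn (f := fderiv ℝ F)
    (hF.continuous_fderiv (by norm_num)).continuousOn
  refine ⟨max a 1, le_max_right _ _, fun y hy z hz => ?_⟩
  exact Convex.norm_image_sub_le_of_norm_fderiv_le (𝕜 := ℝ)
    (fun x _ => hF.differentiable (by norm_num) x)
    (fun x hx => (ha x hx).trans (le_max_left _ _)) (convex_closedBall _ _) hz hy

lemma bilip_ball {F G : P2 → P2} (hF : ContDiff ℝ 2 F) (hG : ContDiff ℝ 2 G)
    (hGF : ∀ x, G (F x) = x) (R : ℝ) :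
    ∃ E : ℝ, 1 ≤ E ∧ ∀ y ∈ Metric.closedBall (0:P2) R, ∀ z ∈ Metric.closedBall (0:P2) R,
      ‖F y - F z‖ ≤ E * ‖y - z‖ ∧ ‖y - z‖ ≤ E * ‖F y - F z‖ := by
  obtain ⟨R', hR'⟩ := (isCompact_closedBall (0:P2) R).exists_bound_of_continuousOn
    hF.continuous.continuousOn
  obtain ⟨E1, h1, h1'⟩ := lip_ball hF R
  obtain ⟨E2, h2, h2'⟩ := lip_ball hG R'
  refine ⟨max E1 E2, le_max_of_le_left h1, fun y hy z hz => ⟨?_, ?_⟩⟩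
  · refine (h1' y hy z hz).trans ?_
    gcongr
    exact le_max_left _ _
  · have := h2' (F y) (mem_closedBall_zero_iff.2 (hR' y hy)) (F z) (mem_closedBall_zero_iff.2 (hR' z hz))
    rw [hGF, hGF] at this
    refine this.trans ?_
    gcongr
    exact le_max_right _ _

def DD (f : P2 → P2) (N : ℕ) (y z : P2) : ℝ := ∏ j ∈ Finset.range N, ‖f^[j] y - f^[j] z‖

lemma DD_nonneg (f : P2 → P2) (N : ℕ) (y z : P2) : 0 ≤ DD f N y z :=
  Finset.prod_nonneg fun _ _ => norm_nonneg _

lemma DD_step (f : P2 → P2) (N : ℕ) (y z : P2) :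
    DD f N (f y) (f z) * ‖y - z‖ = DD f N y z * ‖f^[N] y - f^[N] z‖ := by
  unfold DD
  rw [← Finset.prod_range_succ (fun j => ‖f^[j] y - f^[j] z‖), Finset.prod_range_succ']
  simp [Function.iterate_succ_apply]

lemma DD_self (f : P2 → P2) {N : ℕ} (hN : 1 ≤ N) (y : P2) : DD f N y y = 0 := by
  unfold DD
  exact Finset.prod_eq_zero (i := 0) (by simp; omega) (by simp)

lemma Sys.DD_comp (h : Sys f g μ S) (N : ℕ) (R : ℝ) :
    ∃ E : ℝ, 1 ≤ E ∧ ∀ y ∈ Metric.closedBall (0:P2) R, ∀ z ∈ Metric.closedBall (0:P2) R,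
      DD f N y z ≤ E * ‖y - z‖ ^ N ∧ ‖y - z‖ ^ N ≤ E * DD f N y z := by
  choose E hE1 hE using fun j => bilip_ball (h.cd j) (h.symm.cd j) (h.giter j) R
  refine ⟨∏ j ∈ Finset.range N, E j, ?_, fun y hy z hz => ⟨?_, ?_⟩⟩
  · calc (1:ℝ) = ∏ j ∈ Finset.range N, 1 := by simp
      _ ≤ _ := Finset.prod_le_prod (fun _ _ => zero_le_one) fun j _ => hE1 j
  · calc DD f N y z ≤ ∏ j ∈ Finset.range N, (E j * ‖y - z‖) :=
          Finset.prod_le_prod (fun _ _ => norm_nonneg _) fun j _ => (hE j y hy z hz).1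
      _ = _ := by rw [Finset.prod_mul_distrib]; simp
  · calc ‖y - z‖ ^ N = ∏ j ∈ Finset.range N, ‖y - z‖ := by simp
      _ ≤ ∏ j ∈ Finset.range N, (E j * ‖f^[j] y - f^[j] z‖) :=
          Finset.prod_le_prod (fun _ _ => norm_nonneg _) fun j _ => (hE j y hy z hz).2
      _ = _ := by rw [Finset.prod_mul_distrib]; rfl

lemma Sys.local_lip (h : Sys f g μ S) (N : ℕ) {ε : ℝ} (hε : 0 < ε) :
    ∃ ρ : ℝ, 0 < ρ ∧ ρ ≤ 1 ∧ ∀ x ∈ S, ∀ y ∈ Metric.ball x ρ, ∀ z ∈ Metric.ball x ρ,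
      ‖f^[N] y - f^[N] z‖ ≤ Real.exp (Real.log ‖fderiv ℝ (f^[N]) x‖ + ε) * ‖y - z‖ := by
  obtain ⟨M, hM0, -, hM⟩ := h.log_bounds
  have hcpt : IsCompact (Metric.cthickening 1 S) := h.cpt.cthickening
  have huc := hcpt.uniformContinuousOn_of_continuous (f := fderiv ℝ (f^[N]))
    ((h.cd N).continuous_fderiv (by norm_num)).continuousOn
  rw [Metric.uniformContinuousOn_iff] at huc
  obtain ⟨δ, hδ, hd⟩ := huc (Real.exp (-(M * N)) * ε) (by positivity)
  refine ⟨min δ 1, by positivity, min_le_right _ _, fun x hx y hy z hz => ?_⟩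
  refine Convex.norm_image_sub_le_of_norm_fderiv_le (𝕜 := ℝ) (s := Metric.ball x (min δ 1))
    (fun w _ => h.diff N w) (fun w hw => ?_) (convex_ball _ _) hz hy
  rw [Metric.mem_ball] at hw
  have h1 := hd w (Metric.mem_cthickening_of_dist_le w x 1 S hx (hw.le.trans (min_le_right _ _))) x
    (Metric.self_subset_cthickening _ hx) (hw.trans_le (min_le_left _ _))
  rw [dist_eq_norm] at h1
  have hp := norm_pos_of_dt (h.dt_ne N x)
  have h2 := (abs_le.1 (hM N x hx).1).1
  rw [Real.le_log_iff_exp_le hp] at h2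
  rw [Real.exp_add, Real.exp_log hp]
  have h3 := norm_sub_norm_le (fderiv ℝ (f^[N]) w) (fderiv ℝ (f^[N]) x)
  have h4 := Real.add_one_le_exp ε
  nlinarith

lemma Sys.contract (h : Sys f g μ S) {N : ℕ} (hN : 1 ≤ N) {ε : ℝ} (hε : 0 < ε) (φ : P2 → ℝ)
    (hφ : ∀ x ∈ S, φ x = Real.log ‖fderiv ℝ (f^[N]) x‖ + ε) {x : P2} (hx : x ∈ S) {Q c : ℝ}
    (hQ : 0 ≤ Q) (hc : 0 < c) (hb : ∀ n : ℕ, birkhoffSum f φ n x ≤ Q - c * n) :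
    ∃ E r : ℝ, 0 < r ∧ ∀ n : ℕ, ∀ y ∈ Metric.closedBall x r, ∀ z ∈ Metric.closedBall x r,
      ‖f^[n] y - f^[n] z‖ ^ N ≤ E * Real.exp (-(c * n)) * ‖y - z‖ ^ N := by
  obtain ⟨ρ, hρ, hρ1, hlip⟩ := h.local_lip N hε
  obtain ⟨R1, hR1⟩ := h.cpt.isBounded.exists_norm_le
  obtain ⟨R2, hR2⟩ := (isCompact_closedBall (0:P2) (R1 + 1)).exists_bound_of_continuousOn
    h.hf.continuous.continuousOn
  set R := max (R1 + 1) R2 with hR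
  obtain ⟨E, hE1, hE⟩ := h.DD_comp N R
  have hxn : ∀ n, f^[n] x ∈ S := fun n => (h.inv_iter n x).2 hx
  have hnear : ∀ n, ∀ y, f^[n] y ∈ Metric.ball (f^[n] x) ρ → ‖f^[n] y‖ ≤ R1 + 1 := by
    intro n y hy
    have h1 := hR1 _ (hxn n)
    rw [Metric.mem_ball, dist_eq_norm] at hy
    have := norm_sub_norm_le (f^[n] y) (f^[n] x)
    linarith
  have hDD : ∀ n, ∀ y z, (∀ k < n, f^[k] y ∈ Metric.ball (f^[k] x) ρ ∧ f^[k] z ∈ Metric.ball (f^[k] x) ρ) →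
      DD f N (f^[n] y) (f^[n] z) ≤ Real.exp (birkhoffSum f φ n x) * DD f N y z := by
    intro n y z
    induction n with
    | zero => intro _; simp
    | succ n ih =>
      intro hk
      have h1 := ih fun k hk' => hk k (by omega)
      obtain ⟨hy, hz⟩ := hk n (by omega)
      have h2 := hlip _ (hxn n) _ hy _ hz
      rw [← hφ _ (hxn n)] at h2
      rw [birkhoffSum_succ, Function.iterate_succ_apply', Function.iterate_succ_apply']
      rw [Real.exp_add]
      have h3 := DD_step f N (f^[n] y) (f^[n] z)
      have h0 := DD_nonneg f N (f^[n] y) (f^[n] z)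
      by_cases hyz : f^[n] y = f^[n] z
      · rw [hyz, DD_self f hN]
        have := DD_nonneg f N y z
        positivity
      · have hp : 0 < ‖f^[n] y - f^[n] z‖ := norm_pos_iff.2 (sub_ne_zero.2 hyz)
        refine le_of_mul_le_mul_right ?_ hp
        rw [h3]
        calc _ ≤ (Real.exp (birkhoffSum f φ n x) * DD f N y z) *
              (Real.exp (φ (f^[n] x)) * ‖f^[n] y - f^[n] z‖) := by
                gcongr
                exact h0.trans h1
          _ = _ := by ring
  set G := E * E * Real.exp Q with hG
  have hG1 : 1 ≤ G := by
    have : 1 ≤ Real.exp Q := Real.one_le_exp hQ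
    rw [hG]; nlinarith [mul_le_mul hE1 hE1 zero_le_one (by linarith)]
  have hG0 : 0 < G := by linarith
  -- main estimate
  have hmain : ∀ n, ∀ y z, y ∈ Metric.closedBall (0:P2) R → z ∈ Metric.closedBall (0:P2) R →
      f^[n] y ∈ Metric.closedBall (0:P2) R → f^[n] z ∈ Metric.closedBall (0:P2) R →
      (∀ k < n, f^[k] y ∈ Metric.ball (f^[k] x) ρ ∧ f^[k] z ∈ Metric.ball (f^[k] x) ρ) →
      ‖f^[n] y - f^[n] z‖ ^ N ≤ G * Real.exp (-(c * n)) * ‖y - z‖ ^ N := by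
    intro n y z hy hz hy' hz' hk
    have h1 := hDD n y z hk
    have h2 := (hE _ hy _ hz).1
    have h3 := (hE _ hy' _ hz').2
    have h4 : Real.exp (birkhoffSum f φ n x) ≤ Real.exp Q * Real.exp (-(c * n)) := by
      rw [← Real.exp_add]; exact Real.exp_le_exp.2 (by linarith [hb n])
    have h5 := DD_nonneg f N y z
    calc _ ≤ E * DD f N (f^[n] y) (f^[n] z) := h3
      _ ≤ E * ((Real.exp Q * Real.exp (-(c * n))) * (E * ‖y - z‖ ^ N)) := by
          gcongr
          exact h1.trans (by gcongr)
      _ = _ := by rw [hG]; ring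
  set r := ρ / (2 * G) with hr
  have hr0 : 0 < r := by positivity
  have hrG : G * r = ρ / 2 := by rw [hr]; field_simp
  have hrρ : r < ρ := by nlinarith
  have hball0 : ∀ y ∈ Metric.closedBall x r, y ∈ Metric.closedBall (0:P2) R := by
    intro y hy
    rw [mem_closedBall_zero_iff]
    exact (hnear 0 y (by simpa using lt_of_le_of_lt hy hrρ)).trans (le_max_left _ _)
  have hstay : ∀ n, ∀ y ∈ Metric.closedBall x r, f^[n] y ∈ Metric.ball (f^[n] x) ρ := by
    intro n
    induction n using Nat.strong_induction_on with
    | _ n ih =>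
      intro y hy
      have hyn : ∀ y ∈ Metric.closedBall x r, f^[n] y ∈ Metric.closedBall (0:P2) R := by
        intro y hy
        rcases n with _ | n
        · exact hball0 y hy
        · rw [mem_closedBall_zero_iff, Function.iterate_succ_apply']
          refine (hR2 _ ?_).trans (le_max_right _ _)
          rw [mem_closedBall_zero_iff]
          exact hnear n y (ih n (by omega) y hy)
      have hxx : x ∈ Metric.closedBall x r := Metric.mem_closedBall_self hr0.le
      have h1 := hmain n y x (hball0 y hy) (hball0 x hxx) (hyn y hy) (hyn x hxx)
        fun k hk => ⟨ih k hk y hy, ih k hk x hxx⟩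
      have h2 : Real.exp (-(c * n)) ≤ 1 := by
        rw [Real.exp_le_one_iff]
        have : 0 ≤ c * n := by positivity
        linarith
      have h3 : ‖f^[n] y - f^[n] x‖ ^ N ≤ (G * ‖y - x‖) ^ N := by
        refine h1.trans ?_
        rw [mul_pow]
        gcongr
        calc G * Real.exp (-(c * n)) ≤ G * 1 := by gcongr
          _ = G ^ 1 := by simp
          _ ≤ G ^ N := pow_le_pow_right₀ hG1 hN
      have h4 := le_of_pow_le_pow_left₀ (by omega) (by positivity) h3
      rw [Metric.mem_closedBall, dist_eq_norm] at hy
      rw [Metric.mem_ball, dist_eq_norm]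
      have : G * ‖y - x‖ ≤ G * r := by gcongr
      linarith
  refine ⟨G, r, hr0, fun n y hy z hz => ?_⟩
  have hR' : ∀ y ∈ Metric.closedBall x r, f^[n] y ∈ Metric.closedBall (0:P2) R := fun y hy => by
    rw [mem_closedBall_zero_iff]
    exact (hnear n y (hstay n y hy)).trans (le_max_left _ _)
  exact hmain n y z (hball0 y hy) (hball0 z hz) (hR' y hy) (hR' z hz)
    fun k _ => ⟨hstay k y hy, hstay k z hz⟩

lemma attr_of_contract (F : P2 → P2) (hF : Differentiable ℝ F) (x : P2) {r : ℝ} (hr : 0 < r)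
    (hx : dist (F x) x < r / 4)
    (hc : ∀ y ∈ Metric.closedBall x r, ∀ z ∈ Metric.closedBall x r, ‖F y - F z‖ ≤ 1 / 2 * ‖y - z‖) :
    ∃ p, F p = p ∧ ‖fderiv ℝ F p‖ < 1 := by
  have hxx : x ∈ Metric.closedBall x r := Metric.mem_closedBall_self hr.le
  have hb : ∀ y ∈ Metric.closedBall x r, F y ∈ Metric.ball x r := by
    intro y hy
    have h1 := hc y hy x hxx
    rw [← dist_eq_norm, ← dist_eq_norm] at h1
    rw [Metric.mem_closedBall] at hy
    rw [Metric.mem_ball]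
    linarith [dist_triangle (F y) (F x) x]
  have hmaps : Set.MapsTo F (Metric.closedBall x r) (Metric.closedBall x r) :=
    fun y hy => Metric.ball_subset_closedBall (hb y hy)
  have hlip : LipschitzOnWith (1/2) F (Metric.closedBall x r) := by
    refine LipschitzOnWith.of_dist_le_mul fun y hy z hz => ?_
    rw [dist_eq_norm, dist_eq_norm]
    simpa using hc y hy z hz
  obtain ⟨p, hp, hfix, -⟩ := ContractingWith.exists_fixedPoint' (K := 1/2)
    Metric.isClosed_closedBall.isComplete hmaps
    ⟨NNReal.half_lt_self one_ne_zero, hlip.mapsToRestrict hmaps⟩ hxx (edist_ne_top _ _)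
  refine ⟨p, hfix, ?_⟩
  have hpb : p ∈ Metric.ball x r := by rw [← hfix]; exact hb p hp
  have h1 := (hF p).hasFDerivAt.le_of_lipschitzOn
    (mem_of_superset (Metric.isOpen_ball.mem_nhds hpb) Metric.ball_subset_closedBall) hlip
  refine h1.trans_lt ?_
  norm_num

lemma Sys.exp_nonneg (h : Sys f g μ S) [IsProbabilityMeasure μ] {l d : ℝ} (e : Exps f μ l d)
    (hno : ∀ (p : P2) (n : ℕ), 1 ≤ n → f^[n] p = p → ¬ ‖fderiv ℝ (f^[n]) p‖ < 1) : 0 ≤ l := by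
  by_contra! hl
  obtain ⟨N, hN, hN1⟩ := ((e.il.eventually (gt_mem_nhds hl)).and (eventually_ge_atTop 1)).exists
  set I := -∫ x, Real.log ‖fderiv ℝ (f^[N]) x‖ ∂μ with hI
  have hNp : (0:ℝ) < N := by exact_mod_cast hN1
  have hI0 : 0 < I := by
    rw [div_lt_iff₀ hNp] at hN
    linarith
  obtain ⟨M, hM0, -, hM⟩ := h.log_bounds
  have hSm := h.cpt.isClosed.measurableSet
  set ε := I / 4 with hε
  have hε0 : 0 < ε := by positivity
  set φ : P2 → ℝ := S.indicator (fun x => Real.log ‖fderiv ℝ (f^[N]) x‖ + ε) with hφd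
  have hφ : ∀ x ∈ S, φ x = Real.log ‖fderiv ℝ (f^[N]) x‖ + ε := fun x hx =>
    Set.indicator_of_mem hx _
  have hφm : Measurable φ := ((h.meas_norm N).add_const ε).indicator hSm
  have hφb : ∀ x, |φ x| ≤ M * N + ε := by
    intro x
    by_cases hx : x ∈ S
    · rw [hφ x hx]
      refine (abs_add_le _ _).trans ?_
      rw [abs_of_pos hε0]
      linarith [(hM N x hx).1]
    · rw [hφd, Set.indicator_of_notMem hx, abs_zero]
      positivity
  have hint : Integrable (fun x => Real.log ‖fderiv ℝ (f^[N]) x‖) μ :=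
    Integrable.of_bound (h.meas_norm N).aestronglyMeasurable (M * N) (by
      filter_upwards [h.full] with x hx using (hM N x hx).1)
  have hφi : ∫ x, φ x ∂μ = -I + ε := by
    have : ∫ x, φ x ∂μ = ∫ x, (Real.log ‖fderiv ℝ (f^[N]) x‖ + ε) ∂μ :=
      integral_congr_ae (by filter_upwards [h.full] with x hx using hφ x hx)
    rw [this, integral_add hint (integrable_const _)]
    simp [hI]
  have hbk := birkhoff_tendsto h.erg φ hφm _ hφb
  have hrec := h.erg.toMeasurePreserving.conservative.ae_frequently_mem_of_mem_nhds
  obtain ⟨x, hx1, hx2, hxS⟩ := (hbk.and (hrec.and h.full)).exists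
  have hev := hx1.eventually (gt_mem_nhds (show ∫ x, φ x ∂μ < -(I/2) by rw [hφi, hε]; linarith))
  obtain ⟨n0, hn0⟩ := eventually_atTop.1 (hev.and (eventually_gt_atTop 0))
  set Q := ∑ k ∈ Finset.range n0, |birkhoffSum f φ k x + I / 2 * k| with hQ
  have hQ0 : 0 ≤ Q := Finset.sum_nonneg fun _ _ => abs_nonneg _
  have hb : ∀ n : ℕ, birkhoffSum f φ n x ≤ Q - I / 2 * n := by
    intro n
    by_cases hn : n < n0
    · have h1 : |birkhoffSum f φ n x + I / 2 * n| ≤ Q :=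
        Finset.single_le_sum (f := fun k : ℕ => |birkhoffSum f φ k x + I / 2 * k|)
          (fun _ _ => abs_nonneg _) (Finset.mem_range.2 hn)
      have := le_abs_self (birkhoffSum f φ n x + I / 2 * n)
      linarith
    · obtain ⟨h1, h2⟩ := hn0 n (by omega)
      rw [div_lt_iff₀ (by exact_mod_cast h2)] at h1
      linarith
  obtain ⟨E, r, hr, hE⟩ := h.contract hN1 hε0 φ hφ hxS hQ0 (by positivity : 0 < I / 2) hb
  obtain ⟨n, ⟨hn1, hn2⟩, hn3⟩ := (((hx2 _ (Metric.ball_mem_nhds x (by positivity : 0 < r / 4))).and_eventually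
    (ev_const (E * 2 ^ N) (ε := I / 2) (by positivity))).and_eventually (eventually_ge_atTop 1)).exists
  obtain ⟨p, hp, hp1⟩ := attr_of_contract (f^[n]) (h.diff n) x hr hn1 (fun y hy z hz => by
    refine le_of_pow_le_pow_left₀ (n := N) (by omega) (by positivity) ((hE n y hy z hz).trans ?_)
    rw [mul_pow]
    gcongr
    rw [Real.exp_neg, one_div, inv_pow, ← div_eq_mul_inv, div_le_iff₀ (Real.exp_pos _),
      ← div_eq_inv_mul, le_div_iff₀ (by positivity), mul_comm (I / 2)]
    exact hn2)
  exact hno p n hn3 hp hp1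

end sys3


section sys4
variable {f g : P2 → P2} {μ : Measure P2} {S : Set P2}

lemma exists_sys (hf : ContDiff ℝ 2 f) (hg : ContDiff ℝ 2 g)
    (hgf : ∀ x, g (f x) = x) (hfg : ∀ x, f (g x) = x) (herg : Ergodic f μ)
    (hsupp : ∃ K : Set P2, IsCompact K ∧ μ Kᶜ = 0) : ∃ S, Sys f g μ S := by
  obtain ⟨K, hK, hK0⟩ := hsupp
  let e : P2 ≃ᵐ P2 := ⟨⟨f, g, hgf, hfg⟩, hf.continuous.measurable, hg.continuous.measurable⟩
  have hge : Ergodic g μ := Ergodic.symm (e := e) herg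
  have hcf : ∀ n, Continuous (f^[n]) := fun n => hf.continuous.iterate n
  have hcg : ∀ n, Continuous (g^[n]) := fun n => hg.continuous.iterate n
  refine ⟨{x | ∀ n, f^[n] x ∈ K ∧ g^[n] x ∈ K}, hf, hg, hgf, hfg, herg, hge, ?_, ?_, ?_⟩
  · refine hK.of_isClosed_subset ?_ fun x hx => (hx 0).1
    have : {x | ∀ n, f^[n] x ∈ K ∧ g^[n] x ∈ K} = ⋂ n, ((f^[n]) ⁻¹' K ∩ (g^[n]) ⁻¹' K) := by
      ext x; simp
    rw [this]
    exact isClosed_iInter fun n => (hK.isClosed.preimage (hcf n)).inter (hK.isClosed.preimage (hcg n))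
  · intro x
    constructor
    · intro hx n
      constructor
      · rcases n with _ | n
        · have := (hx 1).2
          rwa [Function.iterate_one, hgf] at this
        · exact (hx n).1
      · have := (hx (n+1)).2
        rwa [Function.iterate_succ_apply, hgf] at this
    · intro hx n
      constructor
      · exact (hx (n+1)).1
      · rcases n with _ | n
        · exact (hx 1).1
        · rw [Function.iterate_succ_apply, hgf]; exact (hx n).2
  · have hKa : ∀ᵐ x ∂μ, x ∈ K := hK0
    refine ae_all_iff.2 fun n => ?_
    filter_upwards [(herg.toMeasurePreserving.iterate n).quasiMeasurePreserving.ae hKa,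
      (hge.toMeasurePreserving.iterate n).quasiMeasurePreserving.ae hKa] with x h1 h2 using ⟨h1, h2⟩

lemma Exps.d_le (h : Sys f g μ S) [IsProbabilityMeasure μ] {l d c : ℝ} (e : Exps f μ l d)
    (hc : ∀ x, |dt (fderiv ℝ f x)| ≤ Real.exp c) : d ≤ c := by
  obtain ⟨x, hx, hxS⟩ := (e.rd.and h.full).exists
  refine le_of_tendsto hx ?_
  filter_upwards [eventually_gt_atTop 0] with n hn
  have hn' : (0:ℝ) < n := by exact_mod_cast hn
  rw [div_le_iff₀ hn', Real.log_le_iff_le_exp (abs_pos.2 (h.dt_ne n x))]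
  exact h.dt_iter_le (fun x _ => hc x) n x hxS

lemma dz_tendsto_top {x v : P2} {χ : ℝ} (h : Rate (fun n => ‖fderiv ℝ (f^[n]) x v‖) χ) :
    Tendsto (fun n : ℤ => ((n : ℝ))⁻¹ * Real.log ‖DiterZ f g x n v‖) atTop (nhds χ) := by
  rw [← Nat.map_cast_int_atTop, tendsto_map'_iff]
  refine h.congr fun n => ?_
  simp [DiterZ, div_eq_inv_mul]

lemma dz_tendsto_bot {x v : P2} {χ : ℝ} (h : Rate (fun n => ‖fderiv ℝ (g^[n]) x v‖) (-χ)) :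
    Tendsto (fun n : ℤ => ((n : ℝ))⁻¹ * Real.log ‖DiterZ f g x n v‖) atBot (nhds χ) := by
  have hb : Tendsto (fun n : ℤ => -n) atBot atTop := tendsto_neg_atBot_atTop
  have h1 : Tendsto (fun n : ℤ => ((-n : ℤ) : ℝ)⁻¹ * Real.log ‖DiterZ f g x (-n) v‖) atTop (nhds χ) := by
    rw [← Nat.map_cast_int_atTop, tendsto_map'_iff]
    have h2 := Tendsto.neg h
    rw [neg_neg] at h2
    refine h2.congr' ?_
    filter_upwards [eventually_gt_atTop 0] with n hn
    have h3 : ¬ (0:ℤ) ≤ -(n:ℤ) := by omega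
    simp only [DiterZ, Function.comp, h3, if_false, neg_neg, Int.toNat_natCast]
    push_cast
    rw [inv_neg, div_eq_inv_mul]; ring
  have h2 := h1.comp hb
  refine h2.congr fun n => ?_
  simp [Function.comp]

lemma Sys.two_exps (h : Sys f g μ S) [IsProbabilityMeasure μ] {l d : ℝ} (e : Exps f μ l d)
    (hgap : d < 2 * l) (hd : d ≤ 0) (hl : 0 ≤ l) : HasTwoLyapunovExponents f g μ (d - l) l := by
  classical
  obtain ⟨l', d', e'⟩ := h.symm.exists_exps
  obtain ⟨rfl, rfl⟩ := h.exps_symm e e'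
  have hgap' : -d < 2 * (l - d) := by linarith
  obtain ⟨L, hpw⟩ := h.ae_pw e hgap
  obtain ⟨L', hpw'⟩ := h.symm.ae_pw e' hgap'
  have hdl : -d - (l - d) = -l := by ring
  have ex1 : ∀ x, ∃ s : P2, PW (fun n => fderiv ℝ (f^[n]) x) l d L →
      s.1 ^ 2 + s.2 ^ 2 = 1 ∧ Slow (fun n => fderiv ℝ (f^[n]) x) (d - l) s := by
    intro x
    by_cases hx : PW (fun n => fderiv ℝ (f^[n]) x) l d L
    · obtain ⟨s, hs⟩ := hx.exists_slow
      exact ⟨s, fun _ => hs⟩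
    · exact ⟨0, fun h => absurd h hx⟩
  have ex2 : ∀ x, ∃ s : P2, PW (fun n => fderiv ℝ (g^[n]) x) (l - d) (-d) L' →
      s.1 ^ 2 + s.2 ^ 2 = 1 ∧ Slow (fun n => fderiv ℝ (g^[n]) x) (-d - (l - d)) s := by
    intro x
    by_cases hx : PW (fun n => fderiv ℝ (g^[n]) x) (l - d) (-d) L'
    · obtain ⟨s, hs⟩ := hx.exists_slow
      exact ⟨s, fun _ => hs⟩
    · exact ⟨0, fun h => absurd h hx⟩
  choose es hes using ex1
  choose eu heu using ex2
  refine ⟨by linarith, es, eu, ?_⟩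
  have hq := h.erg.toMeasurePreserving.quasiMeasurePreserving
  filter_upwards [hpw, hpw', hq.ae hpw, hq.ae hpw', h.transv e hgap] with x p1 p2 q1 q2 htr
  obtain ⟨s1, s2⟩ := hes x p1
  obtain ⟨u1, u2⟩ := heu x p2
  obtain ⟨s3, s4⟩ := hes (f x) q1
  obtain ⟨u3, u4⟩ := heu (f x) q2
  have hw : wd (es x) (eu x) ≠ 0 := htr _ _ (circ_ne s1) (circ_ne u1) s2 (by rw [← hdl]; exact u2)
  have hw' : wd (eu x) (es x) ≠ 0 := by
    intro h0; apply hw; unfold wd at *; linarith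
  refine ⟨?_, ?_, ?_, ?_, ?_, ?_, ?_⟩
  · rw [LinearIndependent.pair_iff]
    intro a b hab
    have h1 : a * wd (es x) (eu x) = 0 := by
      have : wd (a • es x + b • eu x) (eu x) = a * wd (es x) (eu x) := by
        simp [wd]; ring
      rw [← this, hab]; simp [wd]
    have h2 : b * wd (es x) (eu x) = 0 := by
      have : wd (es x) (a • es x + b • eu x) = b * wd (es x) (eu x) := by
        simp [wd]; ring
      rw [← this, hab]; simp [wd]
    exact ⟨(mul_eq_zero.1 h1).resolve_right hw, (mul_eq_zero.1 h2).resolve_right hw⟩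
  · apply eq_smul_of_wd (circ_ne s3)
    set ε := (2 * l - d) / 4 with hε
    have hε0 : 0 < ε := by rw [hε]; linarith
    refine q1.slow_unique s4 (d - l + 2 * ε) (by rw [hε]; linarith) (Eventually.frequently ?_)
    filter_upwards [(tendsto_add_atTop_nat 1).eventually (s2 ε hε0),
      ev_const (Real.exp (d - l + ε)) hε0] with m h1 h2
    beta_reduce at h1
    rw [add_comm m 1, h.chain, Function.iterate_one] at h1
    refine le_trans h1 ?_
    calc Real.exp (((1 + m : ℕ) : ℝ) * (d - l + ε)) = Real.exp (d - l + ε) * Real.exp (m * (d - l + ε)) := by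
          rw [← Real.exp_add]; congr 1; push_cast; ring
      _ ≤ Real.exp (m * ε) * Real.exp (m * (d - l + ε)) := by gcongr
      _ = _ := by rw [← Real.exp_add]; congr 1; ring
  · apply eq_smul_of_wd (circ_ne u3)
    set ε := (2 * l - d) / 4 with hε
    have hε0 : 0 < ε := by rw [hε]; linarith
    refine q2.slow_unique u4 (-l + 2 * ε) (by rw [hε]; linarith) (Eventually.frequently ?_)
    have key : ∀ m : ℕ, fderiv ℝ (g^[1 + m]) (f x) (fderiv ℝ f x (eu x)) = fderiv ℝ (g^[m]) x (eu x) := by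
      intro m
      rw [h.symm.chain, Function.iterate_one, h.gf]
      have := h.ginv 1 x
      rw [Function.iterate_one, Function.iterate_one] at this
      have := congrArg (fun T : P2 →L[ℝ] P2 => T (eu x)) this
      simp only [ContinuousLinearMap.comp_apply, ContinuousLinearMap.id_apply] at this
      rw [ContinuousLinearMap.comp_apply, this]
    have h0 := u2 ε hε0
    rw [hdl] at h0
    rw [eventually_atTop] at h0 ⊢
    obtain ⟨N, hN⟩ := h0
    obtain ⟨N2, hN2⟩ := eventually_atTop.1 (ev_const (Real.exp (-(-l + ε))) hε0)
    refine ⟨N + N2 + 1, fun m hm => ?_⟩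
    obtain ⟨k, rfl⟩ : ∃ k, m = 1 + k := ⟨m - 1, by omega⟩
    beta_reduce
    rw [key]
    refine (hN k (by omega)).trans ?_
    have h2 := hN2 (1 + k) (by omega)
    calc Real.exp (k * (-l + ε)) = Real.exp (-(-l + ε)) * Real.exp (((1 + k : ℕ) : ℝ) * (-l + ε)) := by
          rw [← Real.exp_add]; congr 1; push_cast; ring
      _ ≤ Real.exp (((1 + k : ℕ) : ℝ) * ε) * Real.exp (((1 + k : ℕ) : ℝ) * (-l + ε)) := by gcongr
      _ = _ := by rw [← Real.exp_add]; congr 1; ring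
  · exact dz_tendsto_top (p1.rate_slow (circ_ne s1) s2)
  · apply dz_tendsto_bot
    rw [neg_sub]
    exact p2.rate_fast u2 hw'
  · exact dz_tendsto_top (p1.rate_fast s2 hw)
  · apply dz_tendsto_bot
    rw [← hdl]
    exact p2.rate_slow (circ_ne u1) u2

end sys4


/-- Let `C ≥ 1`, `b ∈ (0,1)` with `b ≤ C⁻³`, and let `f` be a C²
diffeomorphism of the plane with `|det D_x f| ≤ C b` everywhere and no
hyperbolic attracting periodic point.  Then every ergodic invariant Borel
probability measure with compact support has two Lyapunov exponents
`χˢ(μ) < χᵘ(μ)` with `χˢ(μ) ≤ (1/3) log b < 0 ≤ χᵘ(μ)`. -/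
theorem stmt1 (C b : ℝ) (hC : 1 ≤ C) (hb0 : 0 < b) (hb1 : b < 1)
    (hbC : b ≤ (C ^ 3)⁻¹)
    (f g : P2 → P2) (hf : ContDiff ℝ 2 f) (hg : ContDiff ℝ 2 g)
    (hgf : Function.LeftInverse g f) (hfg : Function.RightInverse g f)
    (hdet : ∀ x : P2, |LinearMap.det ((fderiv ℝ f x).toLinearMap)| ≤ C * b)
    (hnoattr : ¬ ∃ (p : P2) (N m : ℕ), 1 ≤ N ∧ 1 ≤ m ∧ f^[N] p = p ∧
      ‖(fderiv ℝ (f^[N]) p) ^ m‖ < 1)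
    (μ : Measure P2) [IsProbabilityMeasure μ] (herg : Ergodic f μ)
    (hsupp : ∃ K : Set P2, IsCompact K ∧ μ Kᶜ = 0) :
    ∃ χs χu : ℝ, HasTwoLyapunovExponents f g μ χs χu ∧
      χs ≤ (1 / 3) * Real.log b ∧ (1 / 3) * Real.log b < 0 ∧ 0 ≤ χu := by
  obtain ⟨S, h⟩ := exists_sys hf hg hgf hfg herg hsupp
  obtain ⟨l, d, e⟩ := h.exists_exps
  have hC0 : 0 < C := by linarith
  have hd1 : d ≤ Real.log (C * b) := e.d_le h fun x => by
    rw [Real.exp_log (by positivity)]; exact hdet x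
  have hlb : Real.log b < 0 := Real.log_neg hb0 hb1
  have hlc : Real.log b ≤ -(3 * Real.log C) := by
    have := Real.log_le_log hb0 hbC
    rw [Real.log_inv, Real.log_pow] at this
    exact_mod_cast this
  rw [Real.log_mul hC0.ne' hb0.ne'] at hd1
  have hl : 0 ≤ l := h.exp_nonneg e fun p n hn hp hlt =>
    hnoattr ⟨p, n, 1, hn, le_refl 1, hp, by rwa [pow_one]⟩
  refine ⟨d - l, l, h.two_exps e (by linarith) (by linarith) hl, by linarith, by linarith, hl⟩

end
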